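/- arXiv:1708.07195 — 2 statements merged into one kernel-verified Lean document; each statement's English description precedes it below -/
import Mathlib

section
/- Fix w ∈ A_∞ and 0<p<∞, and let N ≥ s_w, where s_w = ⌊n(r_w/p − 1)⌋_+ is the critical index of w. Then there is a constant C such that for each f ∈ O_N ∩ H^p(w) there exist a finite sequence of nonnegative numbers {λ_k} and a finite sequence {a_k} of (N,∞) atoms, with supp(a_k) ⊂ Q_k, such that f = Σ_k λ_k a_k and ‖Σ_k λ_k χ_{Q_k}‖_{L^p(w)} ≤ C ‖f‖_{H^p(w)}. -/
open MeasureTheory Set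
open scoped ENNReal BigOperators NNReal

noncomputable section

namespace Paper

/-! ### Iterated partial derivatives and multi-indices -/

/-- Partial derivative in the `i`-th coordinate direction. -/
def pd {ι : Type*} [Fintype ι] [DecidableEq ι] (i : ι) (f : (ι → ℝ) → ℝ) :
    (ι → ℝ) → ℝ :=
  fun x => fderiv ℝ f x (Pi.single i 1)

/-- Iterated partial derivatives along a list of coordinate directions. -/
def pdList {ι : Type*} [Fintype ι] [DecidableEq ι] :
    List ι → ((ι → ℝ) → ℝ) → (ι → ℝ) → ℝ
  | [], f => f
  | i :: l, f => pdList l (pd i f)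

/-- `∂^α f` for a multi-index `α`. -/
def pdMulti {ι : Type*} [Fintype ι] [DecidableEq ι] (α : ι → ℕ)
    (f : (ι → ℝ) → ℝ) : (ι → ℝ) → ℝ :=
  pdList (Finset.univ.toList.flatMap fun i => List.replicate (α i) i) f

/-- All multi-indices on `Fin n` of total degree at most `N`. -/
def multiIndices (n N : ℕ) : Finset (Fin n → ℕ) :=
  ((Finset.univ : Finset (Fin n → Fin (N + 1))).image fun g i => (g i : ℕ)).filter
    fun α => ∑ i, α i ≤ N

/-! ### Cubes -/

/-- An axis-parallel cube in `ℝⁿ`, given by its center and (positive) side length. -/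
structure Cube (n : ℕ) where
  c : Fin n → ℝ
  h : ℝ
  h_pos : 0 < h

/-- The (closed) cube as a subset of `ℝⁿ`. -/
def Cube.set {n : ℕ} (Q : Cube n) : Set (Fin n → ℝ) :=
  {x | ∀ i, |x i - Q.c i| ≤ Q.h / 2}

/-- The set `τ Q`: the concentric dilate of `Q` by factor `τ`. -/
def Cube.scaleSet {n : ℕ} (τ : ℝ) (Q : Cube n) : Set (Fin n → ℝ) :=
  {x | ∀ i, |x i - Q.c i| ≤ τ * Q.h / 2}

/-- The cube `τ Q` for `τ > 0`. -/
def Cube.scale {n : ℕ} (Q : Cube n) (τ : ℝ) (hτ : 0 < τ) : Cube n :=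
  ⟨Q.c, τ * Q.h, mul_pos hτ Q.h_pos⟩

/-- Characteristic function of a set. -/
def chi {n : ℕ} (s : Set (Fin n → ℝ)) : (Fin n → ℝ) → ℝ :=
  s.indicator fun _ => 1

/-- Average of `w` over a set (w.r.t. Lebesgue measure). -/
def avgOn {n : ℕ} (s : Set (Fin n → ℝ)) (w : (Fin n → ℝ) → ℝ) : ℝ :=
  (∫ x in s, w x) / (volume s).toReal

/-! ### Muckenhoupt weights -/

/-- A weight: nonnegative (indeed a.e. positive) locally integrable function. -/
def IsWeight {n : ℕ} (w : (Fin n → ℝ) → ℝ) : Prop :=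
  LocallyIntegrable w volume ∧ ∀ᵐ x ∂volume, 0 < w x

/-- The Muckenhoupt class `A_1`. -/
def IsA1 {n : ℕ} (w : (Fin n → ℝ) → ℝ) : Prop :=
  IsWeight w ∧ ∃ C : ℝ, ∀ Q : Cube n, ∀ᵐ x ∂volume, x ∈ Q.set → avgOn Q.set w ≤ C * w x

/-- The `A_1` characteristic `[w]_{A_1}` (the least admissible constant). -/
def A1Const {n : ℕ} (w : (Fin n → ℝ) → ℝ) : ℝ :=
  sInf {C : ℝ | ∀ Q : Cube n, ∀ᵐ x ∂volume, x ∈ Q.set → avgOn Q.set w ≤ C * w x}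

/-- The Muckenhoupt class `A_q` for `1 < q < ∞`; note `1 - q' = 1 - (1 - q⁻¹)⁻¹`. -/
def IsAq {n : ℕ} (w : (Fin n → ℝ) → ℝ) (q : ℝ) : Prop :=
  IsWeight w ∧ ∃ C : ℝ, ∀ Q : Cube n,
    avgOn Q.set w * avgOn Q.set (fun x => w x ^ (1 - (1 - q⁻¹)⁻¹)) ^ (q - 1) ≤ C

/-- `w ∈ A_q` for `1 ≤ q < ∞`. -/
def IsAqGen {n : ℕ} (w : (Fin n → ℝ) → ℝ) (q : ℝ) : Prop :=
  (q = 1 ∧ IsA1 w) ∨ (1 < q ∧ IsAq w q)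

/-- The class `A_∞`: the union of all the `A_q` classes. -/
def IsAinf {n : ℕ} (w : (Fin n → ℝ) → ℝ) : Prop :=
  IsA1 w ∨ ∃ q : ℝ, 1 < q ∧ IsAq w q

/-- `r_w = inf {r ∈ (1,∞) : w ∈ A_r}`. -/
def rIndex {n : ℕ} (w : (Fin n → ℝ) → ℝ) : ℝ :=
  sInf {r : ℝ | 1 < r ∧ IsAq w r}

/-- `⌊x⌋₊ = max (⌊x⌋, 0)` as an integer. -/
def floorPos (x : ℝ) : ℤ := max ⌊x⌋ 0

/-- The critical index `s_w = ⌊n (r_w/p - 1)⌋₊`. -/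
def critIndex {n : ℕ} (w : (Fin n → ℝ) → ℝ) (p : ℝ) : ℤ :=
  floorPos ((n : ℝ) * (rIndex w / p - 1))

/-! ### Weighted and variable Lebesgue norms -/

/-- The measure `w dx`. -/
def wMeasure {n : ℕ} (w : (Fin n → ℝ) → ℝ) : Measure (Fin n → ℝ) :=
  volume.withDensity fun x => ENNReal.ofReal (w x)

/-- `L^p(μ)` norm of an `ℝ≥0∞`-valued function. -/
def eLpNormE {n : ℕ} (p : ℝ) (μ : Measure (Fin n → ℝ)) (g : (Fin n → ℝ) → ℝ≥0∞) : ℝ≥0∞ :=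
  (∫⁻ x, g x ^ p ∂μ) ^ (1 / p)

/-- Weighted `L^p(w)` norm of an `ℝ≥0∞`-valued function. -/
def wLpNormE {n : ℕ} (p : ℝ) (w : (Fin n → ℝ) → ℝ) (g : (Fin n → ℝ) → ℝ≥0∞) : ℝ≥0∞ :=
  eLpNormE p (wMeasure w) g

/-- Weighted `L^p(w)` norm. -/
def wLpNorm {n : ℕ} (p : ℝ) (w f : (Fin n → ℝ) → ℝ) : ℝ≥0∞ :=
  wLpNormE p w fun x => ENNReal.ofReal |f x|

/-- Variable-exponent Lebesgue quasi-norm of an `ℝ≥0∞`-valued function. -/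
def vLpNormE {n : ℕ} (p : (Fin n → ℝ) → ℝ) (g : (Fin n → ℝ) → ℝ≥0∞) : ℝ≥0∞ :=
  sInf {lam : ℝ≥0∞ | 0 < lam ∧ ∫⁻ x, (g x / lam) ^ p x ≤ 1}

/-- Variable-exponent Lebesgue quasi-norm. -/
def vLpNorm {n : ℕ} (p : (Fin n → ℝ) → ℝ) (f : (Fin n → ℝ) → ℝ) : ℝ≥0∞ :=
  vLpNormE p fun x => ENNReal.ofReal |f x|

/-- Log-Hölder continuity of an exponent function. -/
def LogHolder {n : ℕ} (p : (Fin n → ℝ) → ℝ) : Prop :=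
  (∃ C₀ : ℝ, ∀ x y : Fin n → ℝ, 0 < ‖x - y‖ → ‖x - y‖ < 1 / 2 →
    |p x - p y| ≤ C₀ / (-Real.log ‖x - y‖)) ∧
  ∃ Ci pinf : ℝ, ∀ x : Fin n → ℝ, |p x - pinf| ≤ Ci / Real.log (Real.exp 1 + ‖x‖)

/-! ### Maximal functions and Hardy spaces -/

/-- Dilation `φ_t(x) = t^{-n} φ(x/t)`. -/
def dil {n : ℕ} (t : ℝ) (φ : (Fin n → ℝ) → ℝ) : (Fin n → ℝ) → ℝ :=
  fun x => (t ^ n)⁻¹ * φ (t⁻¹ • x)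

/-- Convolution `g * f`. -/
def conv {n : ℕ} (g f : (Fin n → ℝ) → ℝ) (x : Fin n → ℝ) : ℝ :=
  ∫ y, g (x - y) * f y

/-- The normalizing family `𝔉_{N₀}` of Schwartz functions. -/
def frakF (n N₀ : ℕ) : Set ((Fin n → ℝ) → ℝ) :=
  {φ | (∃ ψ : SchwartzMap (Fin n → ℝ) ℝ, ⇑ψ = φ) ∧
    ∫ x, (1 + ‖x‖) ^ N₀ * ∑ α ∈ multiIndices n N₀, pdMulti α φ x ^ 2 ≤ 1}

/-- The grand maximal function `𝓜_{N₀} f`. -/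
def grandMax (n N₀ : ℕ) (f : (Fin n → ℝ) → ℝ) (x : Fin n → ℝ) : ℝ≥0∞ :=
  ⨆ φ ∈ frakF n N₀, ⨆ (t : ℝ) (_ : 0 < t), ENNReal.ofReal |conv (dil t φ) f x|

/-- Weighted Hardy space quasi-norm `‖f‖_{H^p(w)} = ‖𝓜_{N₀} f‖_{L^p(w)}`. -/
def HpNorm (n N₀ : ℕ) (p : ℝ) (w f : (Fin n → ℝ) → ℝ) : ℝ≥0∞ :=
  wLpNormE p w (grandMax n N₀ f)

/-- Variable Hardy space quasi-norm. -/
def vHpNorm (n N₀ : ℕ) (q : (Fin n → ℝ) → ℝ) (f : (Fin n → ℝ) → ℝ) : ℝ≥0∞ :=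
  vLpNormE q (grandMax n N₀ f)

/-- A fixed smooth bump supported in the unit ball. -/
def IsAdmissiblePhi {n : ℕ} (φ : (Fin n → ℝ) → ℝ) : Prop :=
  ContDiff ℝ (⊤ : ℕ∞) φ ∧ HasCompactSupport φ ∧ tsupport φ ⊆ Metric.ball 0 1

/-- Nontangential maximal operator `M_φ g`. -/
def nontanMax {n : ℕ} (φ g : (Fin n → ℝ) → ℝ) (x : Fin n → ℝ) : ℝ≥0∞ :=
  ⨆ (t : ℝ) (_ : 0 < t) (y : Fin n → ℝ) (_ : ‖y - x‖ < t),
    ENNReal.ofReal |conv (dil t φ) g y|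

/-- The Hardy–Littlewood maximal operator (over cubes). -/
def MHL {n : ℕ} (f : (Fin n → ℝ) → ℝ) (x : Fin n → ℝ) : ℝ≥0∞ :=
  ⨆ (Q : Cube n) (_ : x ∈ Q.set),
    (∫⁻ y in Q.set, ENNReal.ofReal |f y|) / volume Q.set

/-! ### Atoms and the class `O_N` -/

/-- An `(N,∞)` atom supported in the cube `Q`. -/
def IsAtom {n : ℕ} (N : ℕ) (a : (Fin n → ℝ) → ℝ) (Q : Cube n) : Prop :=
  Measurable a ∧ (∀ x ∉ Q.set, a x = 0) ∧ (∀ᵐ x ∂volume, |a x| ≤ 1) ∧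
    ∀ β : Fin n → ℕ, (∑ i, β i) ≤ N → ∫ x, (∏ i, x i ^ β i) * a x = 0

/-- The class `O_N` of smooth compactly supported functions with vanishing
moments up to order `N`. -/
def ON (n N : ℕ) : Set ((Fin n → ℝ) → ℝ) :=
  {f | ContDiff ℝ (⊤ : ℕ∞) f ∧ HasCompactSupport f ∧
    ∀ α : Fin n → ℕ, (∑ i, α i) ≤ N → ∫ x, (∏ i, x i ^ α i) * f x = 0}

/-! ### Calderón–Zygmund kernels and operators -/

/-- Flatten an `(m+1)`-tuple of points of `ℝⁿ` to a point of `ℝ^{(m+1)n}`. -/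
def flat {n m : ℕ} (y : Fin (m + 1) → Fin n → ℝ) : Fin (m + 1) × Fin n → ℝ :=
  fun q => y q.1 q.2

/-- The kernel regularity condition of order `N`. -/
def KernelReg (n m N : ℕ) (K : (Fin (m + 1) × Fin n → ℝ) → ℝ) : Prop :=
  ∀ α : Fin (m + 1) × Fin n → ℕ, (∑ q, α q) ≤ N →
    ∃ A : ℝ, ∀ y : Fin (m + 1) → Fin n → ℝ, (¬ ∀ k l, y k = y l) →
      |pdMulti α K (flat y)| ≤
        A * (∑ k, ∑ l, ‖y k - y l‖) ^ (-((m * n + ∑ q, α q : ℕ) : ℝ))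

/-- `T` is an `m`-linear Calderón–Zygmund operator associated to the kernel `K`. -/
structure IsMCZO (n m : ℕ) (K : (Fin (m + 1) × Fin n → ℝ) → ℝ)
    (T : (Fin m → (Fin n → ℝ) → ℝ) → (Fin n → ℝ) → ℝ) : Prop where
  map_smul : ∀ (f : Fin m → (Fin n → ℝ) → ℝ) (k : Fin m) (c : ℝ) (g : (Fin n → ℝ) → ℝ),
    T (Function.update f k (c • g)) = c • T (Function.update f k g)
  map_add : ∀ (f : Fin m → (Fin n → ℝ) → ℝ) (k : Fin m) (g₁ g₂ : (Fin n → ℝ) → ℝ),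
    T (Function.update f k (g₁ + g₂)) =
      T (Function.update f k g₁) + T (Function.update f k g₂)
  bounded : ∃ q : Fin m → ℝ, (∀ k, 1 < q k) ∧ ∃ C : ℝ≥0,
    ∀ f : Fin m → (Fin n → ℝ) → ℝ,
      eLpNorm (T f) (ENNReal.ofReal ((∑ k, (q k)⁻¹)⁻¹)) volume ≤
        C * ∏ k, eLpNorm (f k) (ENNReal.ofReal (q k)) volume
  repr : ∀ f : Fin m → (Fin n → ℝ) → ℝ,
    (∀ k, Measurable (f k) ∧ HasCompactSupport (f k) ∧ ∃ B : ℝ, ∀ x, |f k x| ≤ B) →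
    ∀ x, x ∉ ⋂ k, tsupport (f k) →
      T f x = ∫ y : Fin m → Fin n → ℝ, K (flat (Fin.cons x y)) * ∏ k, f k (y k)

/-- `1/p = 1/p₁ + ⋯ + 1/p_m`. -/
def pbar {m : ℕ} (p : Fin m → ℝ) : ℝ := (∑ k, (p k)⁻¹)⁻¹

/-- `w̄ = ∏ w_k^{p/p_k}`. -/
def wbar {n m : ℕ} (p : Fin m → ℝ) (w : Fin m → (Fin n → ℝ) → ℝ) :
    (Fin n → ℝ) → ℝ :=
  fun x => ∏ k, w k x ^ (pbar p / p k)

/-! ### Bounded measurable functions with bounded support -/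

/-- Bounded measurable functions with bounded support. -/
def Nice {E : Type*} [NormedAddCommGroup E] [MeasurableSpace E] (g : E → ℝ) : Prop :=
  Measurable g ∧ (∃ B, ∀ y, |g y| ≤ B) ∧ ∃ r, ∀ y, r < ‖y‖ → g y = 0

section Nice

variable {E : Type*} [NormedAddCommGroup E] [MeasurableSpace E]

lemma Nice.mul_bdd {g m : E → ℝ} (hg : Nice g) (hm : Measurable m) {B : ℝ}
    (hB : ∀ y, |m y| ≤ B) : Nice fun y => m y * g y := by
  obtain ⟨h1, ⟨b, hb⟩, r, hr⟩ := hg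
  refine ⟨hm.mul h1, ⟨B * b, fun y => ?_⟩, r, fun y hy => by simp [hr y hy]⟩
  rw [abs_mul]
  exact mul_le_mul (hB y) (hb y) (abs_nonneg _) ((abs_nonneg _).trans (hB y))

lemma Nice.const_mul {g : E → ℝ} (hg : Nice g) (c : ℝ) : Nice fun y => c * g y :=
  hg.mul_bdd measurable_const (B := |c|) fun _ => le_rfl

lemma Nice.add {f g : E → ℝ} (hf : Nice f) (hg : Nice g) : Nice fun y => f y + g y := by
  obtain ⟨h1, ⟨b, hb⟩, r, hr⟩ := hf
  obtain ⟨h1', ⟨b', hb'⟩, r', hr'⟩ := hg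
  refine ⟨h1.add h1', ⟨b + b', fun y => (abs_add_le _ _).trans (add_le_add (hb y) (hb' y))⟩,
    max r r', fun y hy => ?_⟩
  beta_reduce
  rw [hr y ((le_max_left _ _).trans_lt hy), hr' y ((le_max_right _ _).trans_lt hy), add_zero]

lemma Nice.sub {f g : E → ℝ} (hf : Nice f) (hg : Nice g) : Nice fun y => f y - g y := by
  simpa [sub_eq_add_neg] using hf.add (hg.const_mul (-1))

lemma nice_zero : Nice fun _ : E => (0 : ℝ) :=
  ⟨measurable_const, ⟨0, by simp⟩, 0, by simp⟩

lemma Nice.sum {ι : Type*} {s : Finset ι} {f : ι → E → ℝ} (h : ∀ i ∈ s, Nice (f i)) :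
    Nice fun y => ∑ i ∈ s, f i y := by
  classical
  induction s using Finset.induction_on with
  | empty => simpa using nice_zero
  | insert a s ha ih =>
    simp only [Finset.sum_insert ha]
    exact (h a (by simp)).add (ih fun i hi => h i (by simp [hi]))

lemma Nice.comp_sub_left {g : E → ℝ} (hg : Nice g) (x : E) [MeasurableSub E] :
    Nice fun y => g (x - y) := by
  obtain ⟨h1, ⟨b, hb⟩, r, hr⟩ := hg
  refine ⟨h1.comp (measurable_id.const_sub x), ⟨b, fun y => hb _⟩, r + ‖x‖, fun y hy => hr _ ?_⟩
  have := norm_sub_norm_le y x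
  rw [norm_sub_rev] at this
  linarith

variable [ProperSpace E]

lemma Nice.integrable {g : E → ℝ} (hg : Nice g) (μ : Measure E) [IsFiniteMeasureOnCompacts μ] :
    Integrable g μ := by
  obtain ⟨h1, ⟨b, hb⟩, r, hr⟩ := hg
  have hsub : Function.support g ⊆ Metric.closedBall (0 : E) r := by
    intro y hy
    by_contra h
    exact hy (hr y (by simpa using h))
  rw [← integrableOn_iff_integrable_of_support_subset hsub]
  refine Measure.integrableOn_of_bounded (M := b)
    (isCompact_closedBall (0 : E) r).measure_lt_top.ne h1.aestronglyMeasurable ?_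
  exact Filter.Eventually.of_forall hb

variable [BorelSpace E]

lemma Nice.mul_continuous {g m : E → ℝ} (hg : Nice g) (hm : Continuous m) :
    Nice fun y => m y * g y := by
  obtain ⟨h1, ⟨b, hb⟩, r, hr⟩ := hg
  obtain ⟨C, hC⟩ := (isCompact_closedBall (0 : E) r).exists_bound_of_continuousOn hm.continuousOn
  refine ⟨hm.measurable.mul h1, ⟨|C| * b, fun y => ?_⟩, r, fun y hy => by simp [hr y hy]⟩
  rcases le_or_gt ‖y‖ r with h | h
  · rw [abs_mul]
    refine mul_le_mul ((hC y (by simpa using h)).trans (le_abs_self _)) (hb y) (abs_nonneg _)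
      (abs_nonneg _)
  · simp only [hr y h, mul_zero, abs_zero]
    exact mul_nonneg (abs_nonneg _) ((abs_nonneg _).trans (hb y))

lemma nice_of_continuous {g : E → ℝ} (hg : Continuous g) {r : ℝ}
    (hr : ∀ y, r < ‖y‖ → g y = 0) : Nice g := by
  have hc : HasCompactSupport g := by
    refine HasCompactSupport.intro (isCompact_closedBall (0 : E) r) fun y hy => hr y ?_
    simpa using hy
  obtain ⟨C, hC⟩ := hg.bounded_above_of_compact_support hc
  exact ⟨hg.measurable, ⟨C, hC⟩, r, hr⟩

end Nice

/-! ### Convolutions -/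

section Conv

variable {n : ℕ}

lemma Nice.conv_integrand {a g : (Fin n → ℝ) → ℝ} (ha : Nice a) (hg : Nice g)
    (x : Fin n → ℝ) : Nice fun y => a (x - y) * g y := by
  obtain ⟨h1, ⟨b, hb⟩, -⟩ := ha.comp_sub_left x
  exact hg.mul_bdd h1 hb

lemma Nice.conv_integrable {a g : (Fin n → ℝ) → ℝ} (ha : Nice a) (hg : Nice g)
    (x : Fin n → ℝ) : Integrable fun y => a (x - y) * g y :=
  (ha.conv_integrand hg x).integrable _

lemma abs_conv_le {a g : (Fin n → ℝ) → ℝ} (ha : Nice a) {r B : ℝ}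
    (hr : ∀ z, r < ‖z‖ → a z = 0) (x : Fin n → ℝ)
    (hB : ∀ y, ‖x - y‖ ≤ r → |g y| ≤ B) : |conv a g x| ≤ (∫ z, |a z|) * B := by
  have h1 : ∫ y, |a (x - y)| * B = (∫ z, |a z|) * B := by
    rw [integral_mul_const, integral_sub_left_eq_self (fun z => |a z|) volume x]
  rw [← h1, conv, ← Real.norm_eq_abs]
  refine norm_integral_le_of_norm_le (((ha.comp_sub_left x).integrable volume).abs.mul_const B)
    (Filter.Eventually.of_forall fun y => ?_)
  rw [Real.norm_eq_abs, abs_mul]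
  rcases le_or_gt ‖x - y‖ r with h | h
  · exact mul_le_mul_of_nonneg_left (hB y h) (abs_nonneg _)
  · simp [hr _ h]

lemma conv_congr {a g h : (Fin n → ℝ) → ℝ} {r : ℝ} (hr : ∀ z, r < ‖z‖ → a z = 0)
    (x : Fin n → ℝ) (hgh : ∀ y, ‖x - y‖ ≤ r → g y = h y) : conv a g x = conv a h x := by
  refine integral_congr_ae (Filter.Eventually.of_forall fun y => ?_)
  rcases le_or_gt ‖x - y‖ r with h' | h'
  · simp [hgh y h']
  · simp [hr _ h']

lemma conv_eq_zero {a g : (Fin n → ℝ) → ℝ} {r : ℝ} (hr : ∀ z, r < ‖z‖ → a z = 0)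
    (x : Fin n → ℝ) (hg : ∀ y, ‖x - y‖ ≤ r → g y = 0) : conv a g x = 0 := by
  rw [conv_congr (h := fun _ => 0) hr x hg]
  simp [conv]

lemma conv_add_right {a g h : (Fin n → ℝ) → ℝ} (ha : Nice a) (hg : Nice g) (hh : Nice h)
    (x : Fin n → ℝ) : conv a (fun y => g y + h y) x = conv a g x + conv a h x := by
  simp only [conv, mul_add]
  exact integral_add (ha.conv_integrable hg x) (ha.conv_integrable hh x)

lemma conv_sub_left {a b g : (Fin n → ℝ) → ℝ} (ha : Nice a) (hb : Nice b) (hg : Nice g)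
    (x : Fin n → ℝ) : conv (fun y => a y - b y) g x = conv a g x - conv b g x := by
  simp only [conv, sub_mul]
  exact integral_sub (ha.conv_integrable hg x) (hb.conv_integrable hg x)

lemma conv_const_mul_right {a g : (Fin n → ℝ) → ℝ} (c : ℝ)
    (x : Fin n → ℝ) : conv a (fun y => c * g y) x = c * conv a g x := by
  simp only [conv, ← integral_const_mul]
  congr 1; ext y; ring

lemma conv_sum_right {ι : Type*} {s : Finset ι} {a : (Fin n → ℝ) → ℝ}
    {g : ι → (Fin n → ℝ) → ℝ} (ha : Nice a) (hg : ∀ i ∈ s, Nice (g i)) (x : Fin n → ℝ) :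
    conv a (fun y => ∑ i ∈ s, g i y) x = ∑ i ∈ s, conv a (g i) x := by
  simp only [conv, Finset.mul_sum]
  exact integral_finsetSum _ fun i hi => ha.conv_integrable (hg i hi) x

lemma conv_support {a g : (Fin n → ℝ) → ℝ} {r r' : ℝ} (hr : ∀ z, r < ‖z‖ → a z = 0)
    (hr' : ∀ y, r' < ‖y‖ → g y = 0) (x : Fin n → ℝ) (hx : r + r' < ‖x‖) : conv a g x = 0 := by
  refine conv_eq_zero hr x fun y hy => hr' y ?_
  have := norm_sub_norm_le x y
  linarith

lemma continuous_conv {a g : (Fin n → ℝ) → ℝ} (ha : Nice a) (hac : Continuous a)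
    (hg : Nice g) : Continuous (conv a g) := by
  have hcs : HasCompactSupport a := by
    obtain ⟨-, -, r, hr⟩ := ha
    refine HasCompactSupport.intro (isCompact_closedBall (0 : Fin n → ℝ) r) fun y hy => hr y ?_
    simpa using hy
  have := hcs.continuous_convolution_right (ContinuousLinearMap.mul ℝ ℝ) (f := g) (μ := volume)
    (hg.integrable volume).locallyIntegrable hac
  convert! this using 1
  ext x
  simp only [conv, convolution, ContinuousLinearMap.mul_apply']
  congr 1; ext y; ring

lemma Nice.conv {a g : (Fin n → ℝ) → ℝ} (ha : Nice a) (hac : Continuous a) (hg : Nice g) :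
    Nice (conv a g) := by
  obtain ⟨r, hr⟩ := ha.2.2
  obtain ⟨r', hr'⟩ := hg.2.2
  exact nice_of_continuous (continuous_conv ha hac hg) (conv_support hr hr')

lemma conv_left_comm {a b g : (Fin n → ℝ) → ℝ} (ha : Nice a) (hb : Nice b) (hg : Nice g)
    (x : Fin n → ℝ) : Paper.conv a (Paper.conv b g) x = Paper.conv b (Paper.conv a g) x := by
  have key : ∀ a b : (Fin n → ℝ) → ℝ, Nice a → Nice b →
      Paper.conv a (Paper.conv b g) x = ∫ u, (∫ y, a (x - y) * b (y - u)) * g u := by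
    intro a b ha hb
    simp only [Paper.conv, ← integral_const_mul, ← integral_mul_const]
    rw [integral_integral_swap]
    · congr 1; ext u; congr 1; ext y; ring
    · refine Nice.integrable ?_ _
      obtain ⟨h1, ⟨B, hB⟩, r, hr⟩ := ha.comp_sub_left x
      obtain ⟨k1, ⟨B', hB'⟩, -⟩ := hb
      obtain ⟨l1, ⟨B'', hB''⟩, r'', hr''⟩ := hg
      refine ⟨?_, ⟨B * (B' * B''), fun z => ?_⟩, max r r'', fun z hz => ?_⟩
      · exact (h1.comp measurable_fst).mul
          ((k1.comp (measurable_fst.sub measurable_snd)).mul (l1.comp measurable_snd))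
      · simp only [Function.uncurry, abs_mul]
        have := abs_nonneg (b (z.1 - z.2))
        have := abs_nonneg (g z.2)
        have := abs_nonneg (a (x - z.1))
        have i2 := hB' (z.1 - z.2)
        have i3 := hB'' z.2
        have i1 := hB z.1
        gcongr
        · linarith
        · linarith
      · simp only [Function.uncurry]
        rw [Prod.norm_def] at hz
        rcases lt_max_iff.1 hz with h | h
        · rw [show a (x - z.1) = 0 from hr _ ((le_max_left _ _).trans_lt h), zero_mul]
        · rw [hr'' _ ((le_max_right _ _).trans_lt h)]; simp
  rw [key a b ha hb, key b a hb ha]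
  congr 1; ext u; congr 1
  rw [← integral_sub_left_eq_self _ volume (x + u)]
  congr 1; ext y
  rw [mul_comm]
  congr 2 <;> abel

/-- The coordinate monomial `x^α`. -/
def mono (α : Fin n → ℕ) (x : Fin n → ℝ) : ℝ := ∏ i, x i ^ α i

lemma continuous_mono (α : Fin n → ℕ) : Continuous (mono α) := by
  unfold mono; fun_prop

/-- `φ` has integral `c` and vanishing moments of orders `1, …, N`. -/
def HasMoments (N : ℕ) (c : ℝ) (φ : (Fin n → ℝ) → ℝ) : Prop :=
  ∀ β : Fin n → ℕ, ∑ i, β i ≤ N → ∫ z, mono β z * φ z = if β = 0 then c else 0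

lemma HasMoments.sub {N : ℕ} {c d : ℝ} {φ ψ : (Fin n → ℝ) → ℝ} (h : HasMoments N c φ)
    (h' : HasMoments N d ψ) (hφ : Nice φ) (hψ : Nice ψ) :
    HasMoments N (c - d) fun x => φ x - ψ x := by
  intro β hβ
  simp only [mul_sub]
  rw [integral_sub ((hφ.mul_continuous (continuous_mono β)).integrable _)
    ((hψ.mul_continuous (continuous_mono β)).integrable _), h β hβ, h' β hβ]
  split_ifs <;> simp

lemma HasMoments.integral_add {N : ℕ} {c : ℝ} {φ : (Fin n → ℝ) → ℝ} (h : HasMoments N c φ)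
    (hφ : Nice φ) {α : Fin n → ℕ} (hα : ∑ i, α i ≤ N) (y : Fin n → ℝ) :
    ∫ z, mono α (z + y) * φ z = c * mono α y := by
  have h1 : ∀ z : Fin n → ℝ, mono α (z + y) * φ z =
      ∑ β ∈ Fintype.piFinset fun i => Finset.range (α i + 1),
        (∏ i, (y i ^ (α i - β i) * ((α i).choose (β i) : ℝ))) * (mono β z * φ z) := by
    intro z
    simp only [mono, Pi.add_apply, add_pow, mul_assoc]
    rw [Finset.prod_univ_sum, Finset.sum_mul]
    refine Finset.sum_congr rfl fun β _ => ?_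
    rw [Finset.prod_mul_distrib]
    ring
  simp only [h1]
  rw [integral_finsetSum _ fun β _ =>
    ((hφ.mul_continuous (continuous_mono β)).integrable _).const_mul _]
  simp only [integral_const_mul]
  rw [Finset.sum_eq_single 0]
  · rw [h 0 (by simp)]
    simp [mono, mul_comm]
  · intro β hβ hne
    rw [h β, if_neg hne, mul_zero]
    refine le_trans (Finset.sum_le_sum fun i _ => ?_) hα
    have := Finset.mem_range.1 (Fintype.mem_piFinset.1 hβ i)
    omega
  · intro h0
    exact absurd (Fintype.mem_piFinset.2 fun i => by simp) h0

lemma moment_conv {N : ℕ} {c : ℝ} {φ g : (Fin n → ℝ) → ℝ} (h : HasMoments N c φ)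
    (hφ : Nice φ) (hg : Nice g) {α : Fin n → ℕ} (hα : ∑ i, α i ≤ N) :
    ∫ x, mono α x * Paper.conv φ g x = c * ∫ y, mono α y * g y := by
  simp only [Paper.conv, ← integral_const_mul]
  rw [integral_integral_swap]
  · congr 1; ext y
    rw [← mul_assoc, ← h.integral_add hφ hα y, ← integral_mul_const,
      ← integral_add_right_eq_self _ y]
    congr 1; ext z
    simp [mul_assoc]
  · refine Nice.integrable ?_ _
    have : Nice fun z : (Fin n → ℝ) × (Fin n → ℝ) => φ (z.1 - z.2) * g z.2 := by
      obtain ⟨h1, ⟨B, hB⟩, r, hr⟩ := hφ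
      obtain ⟨l1, ⟨B', hB'⟩, r', hr'⟩ := hg
      refine ⟨?_, ⟨B * B', fun z => ?_⟩, max (r + r') r', fun z hz => ?_⟩
      · exact (h1.comp (measurable_fst.sub measurable_snd)).mul (l1.comp measurable_snd)
      · rw [abs_mul]
        exact mul_le_mul (hB _) (hB' _) (abs_nonneg _) ((abs_nonneg _).trans (hB 0))
      · beta_reduce
        rcases lt_or_ge r' ‖z.2‖ with h2 | h2
        · rw [hr' _ h2, mul_zero]
        · rw [Prod.norm_def] at hz
          rcases lt_max_iff.1 hz with h | h
          · rw [hr, zero_mul]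
            have := norm_sub_norm_le z.1 z.2
            have := (le_max_left _ _).trans_lt h
            linarith
          · linarith [(le_max_right (r + r') r').trans_lt h]
    exact this.mul_continuous ((continuous_mono α).comp continuous_fst)

end Conv

/-! ### Comparison of convolutions with the grand maximal function -/

section GrandMax

lemma pd_comp_add {n : ℕ} (i : Fin n) (f : (Fin n → ℝ) → ℝ) (h : Fin n → ℝ) :
    pd i (fun x => f (x + h)) = fun x => pd i f (x + h) := by
  ext x
  simp only [pd, fderiv_comp_add_right]

lemma pdList_comp_add {n : ℕ} (l : List (Fin n)) (f : (Fin n → ℝ) → ℝ) (h : Fin n → ℝ) :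
    pdList l (fun x => f (x + h)) = fun x => pdList l f (x + h) := by
  induction l generalizing f with
  | nil => rfl
  | cons i l ih => simp only [pdList, pd_comp_add, ih]

lemma contDiff_pd {n : ℕ} (i : Fin n) {f : (Fin n → ℝ) → ℝ} (hf : ContDiff ℝ (⊤ : ℕ∞) f) :
    ContDiff ℝ (⊤ : ℕ∞) (pd i f) :=
  (hf.fderiv_right (m := (⊤ : ℕ∞)) (by simp)).clm_apply contDiff_const

lemma hasCompactSupport_pd {n : ℕ} (i : Fin n) {f : (Fin n → ℝ) → ℝ}
    (hf : HasCompactSupport f) : HasCompactSupport (pd i f) :=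
  hf.fderiv_apply ℝ _

lemma contDiff_pdList {n : ℕ} (l : List (Fin n)) {f : (Fin n → ℝ) → ℝ}
    (hf : ContDiff ℝ (⊤ : ℕ∞) f) : ContDiff ℝ (⊤ : ℕ∞) (pdList l f) := by
  induction l generalizing f with
  | nil => exact hf
  | cons i l ih => exact ih (contDiff_pd i hf)

lemma hasCompactSupport_pdList {n : ℕ} (l : List (Fin n)) {f : (Fin n → ℝ) → ℝ}
    (hf : HasCompactSupport f) : HasCompactSupport (pdList l f) := by
  induction l generalizing f with
  | nil => exact hf
  | cons i l ih => exact ih (hasCompactSupport_pd i hf)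

lemma pd_const_mul {n : ℕ} (i : Fin n) {f : (Fin n → ℝ) → ℝ}
    (hf : ContDiff ℝ (⊤ : ℕ∞) f) (c : ℝ) :
    pd i (fun x => c * f x) = fun x => c * pd i f x := by
  ext x
  simp only [pd]
  rw [fderiv_const_mul (hf.differentiable (by simp) x)]
  simp

lemma pdList_const_mul {n : ℕ} (l : List (Fin n)) {f : (Fin n → ℝ) → ℝ}
    (hf : ContDiff ℝ (⊤ : ℕ∞) f) (c : ℝ) :
    pdList l (fun x => c * f x) = fun x => c * pdList l f x := by
  induction l generalizing f with
  | nil => rfl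
  | cons i l ih => simp only [pdList, pd_const_mul i hf, ih (contDiff_pd i hf)]

/-- The integrand whose integral normalizes the test functions in `frakF n N₀`. -/
def testDensity (n N₀ : ℕ) (φ : (Fin n → ℝ) → ℝ) (x : Fin n → ℝ) : ℝ :=
  (1 + ‖x‖) ^ N₀ * ∑ α ∈ multiIndices n N₀, pdMulti α φ x ^ 2

lemma testDensity_nonneg (n N₀ : ℕ) (φ : (Fin n → ℝ) → ℝ) (x : Fin n → ℝ) :
    0 ≤ testDensity n N₀ φ x :=
  mul_nonneg (by positivity) (Finset.sum_nonneg fun _ _ => sq_nonneg _)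

lemma integrable_testDensity (n N₀ : ℕ) {φ : (Fin n → ℝ) → ℝ}
    (hφ : ContDiff ℝ (⊤ : ℕ∞) φ) (hc : HasCompactSupport φ) :
    Integrable (testDensity n N₀ φ) := by
  have hcont : ∀ α : Fin n → ℕ, Continuous (pdMulti α φ) := fun α =>
    (contDiff_pdList _ hφ).continuous
  have hcs : HasCompactSupport fun x => ∑ α ∈ multiIndices n N₀, pdMulti α φ x ^ 2 := by
    have h1 : ∀ α : Fin n → ℕ, HasCompactSupport (pdMulti α φ) := fun α =>
      hasCompactSupport_pdList _ hc
    have h2 : IsCompact (⋃ α ∈ multiIndices n N₀, tsupport (pdMulti α φ)) :=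
      (multiIndices n N₀).isCompact_biUnion fun α _ => h1 α
    refine HasCompactSupport.intro h2 fun x hx => Finset.sum_eq_zero fun α hα => ?_
    have : x ∉ tsupport (pdMulti α φ) := fun h => hx (mem_biUnion hα h)
    rw [image_eq_zero_of_notMem_tsupport this]
    simp
  refine Continuous.integrable_of_hasCompactSupport ?_ hcs.mul_left
  exact ((continuous_const.add continuous_norm).pow _).mul
    (continuous_finsetSum _ fun α _ => (hcont α).pow 2)

lemma testDensity_comp_add_le (n N₀ : ℕ) (φ : (Fin n → ℝ) → ℝ) {κ : ℝ}
    {h : Fin n → ℝ} (hh : ‖h‖ ≤ κ) (x : Fin n → ℝ) :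
    testDensity n N₀ (fun x => φ (x + h)) x ≤ (1 + κ) ^ N₀ * testDensity n N₀ φ (x + h) := by
  simp only [testDensity, pdMulti, pdList_comp_add]
  rw [← mul_assoc, ← mul_pow]
  refine mul_le_mul_of_nonneg_right (pow_le_pow_left₀ (by positivity) ?_ _)
    (Finset.sum_nonneg fun _ _ => sq_nonneg _)
  have h1 : ‖x‖ ≤ ‖x + h‖ + ‖h‖ := by
    simpa using norm_sub_le (x + h) h
  nlinarith [norm_nonneg (x + h), norm_nonneg h]

lemma conv_le_grandMax (n N₀ : ℕ) {φ : (Fin n → ℝ) → ℝ} (hφ : ContDiff ℝ (⊤ : ℕ∞) φ)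
    (hc : HasCompactSupport φ) {κ : ℝ} (hκ : 0 ≤ κ) :
    ∃ C : ℝ, 0 < C ∧ ∀ (f : (Fin n → ℝ) → ℝ) (t : ℝ) (y z : Fin n → ℝ), 0 < t →
      ‖y - z‖ ≤ κ * t →
        ENNReal.ofReal |conv (dil t φ) f y| ≤ ENNReal.ofReal C * grandMax n N₀ f z := by
  set I := ∫ x, testDensity n N₀ φ x with hI
  have hI0 : 0 ≤ I := integral_nonneg fun x => testDensity_nonneg n N₀ φ x
  set S := 1 + (1 + κ) ^ N₀ * I with hS
  have hS0 : 0 < S := by positivity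
  refine ⟨√S, Real.sqrt_pos.2 hS0, fun f t y z ht hyz => ?_⟩
  set C := √S with hC
  have hC0 : 0 < C := Real.sqrt_pos.2 hS0
  have hC2 : C ^ 2 = S := Real.sq_sqrt hS0.le
  set h := t⁻¹ • (y - z) with hh
  have hhκ : ‖h‖ ≤ κ := by
    rw [hh, norm_smul, norm_inv, Real.norm_eq_abs, abs_of_pos ht, inv_mul_le_iff₀ ht]
    linarith
  have hsh : ContDiff ℝ (⊤ : ℕ∞) fun x => φ (x + h) := hφ.comp (contDiff_id.add contDiff_const)
  have hshc : HasCompactSupport fun x => φ (x + h) := by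
    exact hc.comp_homeomorph (Homeomorph.addRight h)
  set ψ : (Fin n → ℝ) → ℝ := fun x => C⁻¹ * φ (x + h) with hψ
  have hmem : ψ ∈ frakF n N₀ := by
    refine ⟨⟨(hshc.mul_left (f := fun _ => C⁻¹)).toSchwartzMap (contDiff_const.mul hsh), rfl⟩, ?_⟩
    have h1 : ∀ x, (1 + ‖x‖) ^ N₀ * ∑ α ∈ multiIndices n N₀, pdMulti α ψ x ^ 2 =
        (C ^ 2)⁻¹ * testDensity n N₀ (fun x => φ (x + h)) x := by
      intro x
      simp only [hψ, testDensity, pdMulti, pdList_const_mul _ hsh, mul_pow, ← Finset.mul_sum]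
      rw [inv_pow]; ring
    simp only [h1]
    rw [integral_const_mul, hC2, inv_mul_le_iff₀ hS0, mul_one]
    calc ∫ x, testDensity n N₀ (fun x => φ (x + h)) x
        ≤ ∫ x, (1 + κ) ^ N₀ * testDensity n N₀ φ (x + h) := by
          refine integral_mono (integrable_testDensity n N₀ hsh hshc)
            (((integrable_testDensity n N₀ hφ hc).comp_add_right h).const_mul _)
            fun x => testDensity_comp_add_le n N₀ φ hhκ x
      _ = (1 + κ) ^ N₀ * I := by
          rw [integral_const_mul, integral_add_right_eq_self (testDensity n N₀ φ) h]
      _ ≤ S := by rw [hS]; linarith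
  have hconv : conv (dil t φ) f y = C * conv (dil t ψ) f z := by
    simp only [conv, ← integral_const_mul]
    congr 1; ext u
    have : t⁻¹ • (y - u) = t⁻¹ • (z - u) + h := by
      rw [hh, ← smul_add]; congr 1; abel
    simp only [dil, hψ, this]
    field_simp
  rw [hconv, abs_mul, abs_of_pos hC0, ENNReal.ofReal_mul hC0.le]
  gcongr
  exact le_iSup₂_of_le ψ hmem (le_iSup₂_of_le t ht le_rfl)

end GrandMax

/-! ### Dilations and a test function with vanishing moments -/

section Dil

variable {n : ℕ}

lemma continuous_dil {φ : (Fin n → ℝ) → ℝ} (hφ : Continuous φ) (t : ℝ) :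
    Continuous (dil t φ) := by
  unfold dil; fun_prop

lemma dil_support {φ : (Fin n → ℝ) → ℝ} {t : ℝ} (ht : 0 < t) (h : ∀ z, 1 < ‖z‖ → φ z = 0)
    (z : Fin n → ℝ) (hz : t < ‖z‖) : dil t φ z = 0 := by
  rw [dil, h, mul_zero]
  rw [norm_smul, norm_inv, Real.norm_eq_abs, abs_of_pos ht, lt_inv_mul_iff₀ ht]
  simpa using hz

lemma integral_dil (φ : (Fin n → ℝ) → ℝ) {t : ℝ} (ht : 0 < t) :
    ∫ x, dil t φ x = ∫ x, φ x := by
  simp only [dil]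
  rw [integral_const_mul, Measure.integral_comp_inv_smul_of_nonneg volume φ ht.le]
  simp only [Module.finrank_fintype_fun_eq_card, Fintype.card_fin, smul_eq_mul]
  field_simp

lemma integral_abs_dil (φ : (Fin n → ℝ) → ℝ) {t : ℝ} (ht : 0 < t) :
    ∫ x, |dil t φ x| = ∫ x, |φ x| := by
  rw [← integral_dil (fun x => |φ x|) ht]
  congr 1; ext x
  rw [dil, dil, abs_mul, abs_of_pos (by positivity)]

lemma integral_mono_mul_dil (φ : (Fin n → ℝ) → ℝ) {t : ℝ} (ht : 0 < t) (β : Fin n → ℕ) :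
    ∫ x, mono β x * dil t φ x = t ^ (∑ i, β i) * ∫ x, mono β x * φ x := by
  rw [← integral_dil (fun x => mono β x * φ x) ht, ← integral_const_mul]
  congr 1; ext x
  have : mono β x = t ^ (∑ i, β i) * mono β (t⁻¹ • x) := by
    rw [mono, mono, ← Finset.prod_pow_eq_pow_sum, ← Finset.prod_mul_distrib]
    refine Finset.prod_congr rfl fun i _ => ?_
    rw [← mul_pow]
    simp [ht.ne']
  rw [dil, dil, this]; ring

lemma HasMoments.dil {N : ℕ} {c : ℝ} {φ : (Fin n → ℝ) → ℝ} (h : HasMoments N c φ) {t : ℝ}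
    (ht : 0 < t) : HasMoments N c (dil t φ) := by
  intro β hβ
  rw [integral_mono_mul_dil φ ht, h β hβ]
  split_ifs with h0
  · simp [h0]
  · simp

lemma exists_hasMoments (n N : ℕ) : ∃ φ : (Fin n → ℝ) → ℝ, ContDiff ℝ (⊤ : ℕ∞) φ ∧
    (∀ z, 1 < ‖z‖ → φ z = 0) ∧ HasMoments N 1 φ := by
  induction N with
  | zero =>
    let b : ContDiffBump (0 : Fin n → ℝ) := ⟨1 / 2, 1, by norm_num, by norm_num⟩
    refine ⟨b.normed volume, b.contDiff_normed, fun z hz => ?_, fun β hβ => ?_⟩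
    · have : z ∉ Function.support (b.normed volume) := by
        rw [b.support_normed_eq]
        simpa [b] using hz.le
      simpa using this
    · have : β = 0 := by
        ext i
        have := (Finset.sum_eq_zero_iff.1 (Nat.le_zero.1 hβ)) i (Finset.mem_univ i)
        simpa using this
      subst this
      simp [mono, b.integral_normed]
  | succ N ih =>
    obtain ⟨φ, hφ, hs, hm⟩ := ih
    have hn : Nice φ := nice_of_continuous hφ.continuous hs
    have hhalf : (0 : ℝ) < 1 / 2 := by norm_num
    have hs' : ∀ z, 1 < ‖z‖ → dil (1 / 2) φ z = 0 := fun z hz =>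
      dil_support hhalf hs z (by linarith)
    have hn' : Nice (dil (1 / 2) φ) :=
      nice_of_continuous (continuous_dil hφ.continuous _) hs'
    have hpow : (1 : ℝ) < 2 ^ (N + 1) := one_lt_pow₀ (by norm_num) (by simp)
    refine ⟨fun x => ((2 : ℝ) ^ (N + 1) - 1)⁻¹ * (2 ^ (N + 1) * dil (1 / 2) φ x - φ x),
      ?_, fun z hz => by beta_reduce; rw [hs z hz, hs' z hz]; simp, fun β hβ => ?_⟩
    · refine contDiff_const.mul ((contDiff_const.mul ?_).sub hφ)
      exact contDiff_const.mul (hφ.comp (contDiff_const_smul _))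
    · have e : ∀ x, mono β x * (((2 : ℝ) ^ (N + 1) - 1)⁻¹ *
          (2 ^ (N + 1) * dil (1 / 2) φ x - φ x)) = ((2 : ℝ) ^ (N + 1) - 1)⁻¹ *
          (2 ^ (N + 1) * (mono β x * dil (1 / 2) φ x) - mono β x * φ x) := fun x => by ring
      simp only [e]
      rw [integral_const_mul, integral_sub
        (((hn'.mul_continuous (continuous_mono β)).integrable _).const_mul _)
        ((hn.mul_continuous (continuous_mono β)).integrable _), integral_const_mul,
        integral_mono_mul_dil φ hhalf]
      have hne : (2 : ℝ) ^ (N + 1) - 1 ≠ 0 := by linarith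
      rcases hβ.lt_or_eq with hlt | heq
      · rw [hm β (by omega)]
        split_ifs with h0
        · simp [h0, hne]
        · simp
      · have h0 : β ≠ 0 := by rintro rfl; simp at heq
        rw [heq, if_neg h0, ← mul_assoc, ← mul_pow]
        norm_num

end Dil

/-! ### Sums over scales -/

lemma sum_div_two_pow_le (S : Finset ℕ) {R b : ℝ} (hR : 0 ≤ R) (hb : 0 ≤ b)
    (h : ∀ j ∈ S, R / 2 ^ j ≤ b) : ∑ j ∈ S, R / 2 ^ j ≤ 2 * b := by
  rcases S.eq_empty_or_nonempty with rfl | hne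
  · simpa using hb
  have hsub : S ⊆ Finset.Ico (S.min' hne) (S.max' hne + 1) := fun j hj =>
    Finset.mem_Ico.2 ⟨S.min'_le j hj, Nat.lt_succ_of_le (S.le_max' j hj)⟩
  calc ∑ j ∈ S, R / 2 ^ j
      ≤ ∑ j ∈ Finset.Ico (S.min' hne) (S.max' hne + 1), R / 2 ^ j :=
        Finset.sum_le_sum_of_subset_of_nonneg hsub fun _ _ _ => by positivity
    _ = R * ∑ j ∈ Finset.Ico (S.min' hne) (S.max' hne + 1), (1 / 2 : ℝ) ^ j := by
        rw [Finset.mul_sum]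
        exact Finset.sum_congr rfl fun j _ => by rw [one_div, inv_pow]; rfl
    _ ≤ R * ((1 / 2 : ℝ) ^ S.min' hne / (1 - 1 / 2)) := by
        gcongr
        exact geom_sum_Ico_le_of_lt_one (by norm_num) (by norm_num)
    _ = 2 * (R / 2 ^ S.min' hne) := by rw [one_div, inv_pow]; ring
    _ ≤ 2 * b := by gcongr; exact h _ (S.min'_mem hne)

lemma sum_mul_two_pow_le (S : Finset ℕ) {s b : ℝ} (hs : 0 ≤ s) (hb : 0 ≤ b)
    (h : ∀ k ∈ S, s * 2 ^ k ≤ b) : ∑ k ∈ S, s * 2 ^ k ≤ 2 * b := by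
  rcases S.eq_empty_or_nonempty with rfl | hne
  · simpa using hb
  have hsub : S ⊆ Finset.range (S.max' hne + 1) := fun j hj =>
    Finset.mem_range.2 (Nat.lt_succ_of_le (S.le_max' j hj))
  calc ∑ k ∈ S, s * 2 ^ k
      ≤ ∑ k ∈ Finset.range (S.max' hne + 1), s * 2 ^ k :=
        Finset.sum_le_sum_of_subset_of_nonneg hsub fun _ _ _ => by positivity
    _ = s * (2 ^ (S.max' hne + 1) - 1) := by
        rw [← Finset.mul_sum, geom_sum_eq (by norm_num)]; norm_num
    _ ≤ 2 * (s * 2 ^ S.max' hne) := by rw [pow_succ]; nlinarith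
    _ ≤ 2 * b := by gcongr; exact h _ (S.max'_mem hne)

lemma div_two_pow_succ_le {R : ℝ} (hR : 0 ≤ R) {i j : ℕ} (hij : i < j) :
    2 * (R / 2 ^ j) ≤ R / 2 ^ i := by
  have h1 : R / 2 ^ j ≤ R / 2 ^ (i + 1) := by
    gcongr
    · norm_num
    · exact hij
  have h2 : R / 2 ^ (i + 1) = R / 2 ^ i / 2 := by rw [pow_succ, div_div]
  linarith

/-- A telescoping sum over an order-convex set of indices is controlled by its boundary terms. -/
lemma abs_sum_telescope_le (g : ℕ → ℝ) (S : Finset ℕ) {B : ℝ} (hB : 0 ≤ B)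
    (hconv : ∀ a ∈ S, ∀ b ∈ S, ∀ j, a ≤ j → j ≤ b → j ∈ S)
    (h : ∀ j ∈ S, |g j| ≤ B ∧ |g (j + 1)| ≤ B) :
    |∑ j ∈ S, (g (j + 1) - g j)| ≤ 2 * B := by
  rcases S.eq_empty_or_nonempty with rfl | hne
  · simpa using hB
  have hmin := S.min'_mem hne
  have hmax := S.max'_mem hne
  have hS : S = Finset.Ico (S.min' hne) (S.max' hne + 1) := by
    ext j
    rw [Finset.mem_Ico]
    exact ⟨fun hj => ⟨S.min'_le j hj, Nat.lt_succ_of_le (S.le_max' j hj)⟩,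
      fun hj => hconv _ hmin _ hmax j hj.1 (Nat.le_of_lt_succ hj.2)⟩
  have hle : S.min' hne ≤ S.max' hne + 1 := (S.min'_le _ hmax).trans (Nat.le_succ _)
  have hsum : ∑ j ∈ S, (g (j + 1) - g j) = g (S.max' hne + 1) - g (S.min' hne) := by
    conv_lhs => rw [hS]
    exact Finset.sum_Ico_sub g hle
  rw [hsum]
  have h1 := abs_sub (g (S.max' hne + 1)) (g (S.min' hne))
  linarith [(h _ hmax).2, (h _ hmin).1]

lemma card_transition_le_one {R : ℝ} (hR : 0 < R) (J : ℕ) (a : ℝ) :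
    ((Finset.range J).filter fun j => 15 * (R / 2 ^ j) ≤ a ∧ a < 17 * (R / 2 ^ j)).card ≤ 1 := by
  have key : ∀ i j : ℕ, i < j → 15 * (R / 2 ^ i) ≤ a → a < 17 * (R / 2 ^ j) → False := by
    intro i j hij h1 h2
    have := div_two_pow_succ_le hR.le hij
    have : 0 < R / 2 ^ j := by positivity
    linarith
  refine Finset.card_le_one.2 fun i hi j hj => ?_
  simp only [Finset.mem_filter] at hi hj
  rcases lt_trichotomy i j with h | h | h
  · exact (key i j h hi.2.1 hj.2.2).elim
  · exact h
  · exact (key j i h hj.2.1 hi.2.2).elim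

/-! ### Stopped sums -/

/-- The indicator of `{y | 16 t ≤ D y, e y < 16 t}`. -/
def band {n : ℕ} (D e : (Fin n → ℝ) → ℝ) (t : ℝ) (y : Fin n → ℝ) : ℝ :=
  {y | 16 * t ≤ D y ∧ e y < 16 * t}.indicator (fun _ => (1 : ℝ)) y

lemma measurable_band {n : ℕ} {D e : (Fin n → ℝ) → ℝ} (hD : Continuous D) (he : Continuous e)
    (t : ℝ) : Measurable (band D e t) := by
  refine measurable_const.indicator (MeasurableSet.inter ?_ ?_)
  · exact (isClosed_le continuous_const hD).measurableSet
  · exact (isOpen_lt he continuous_const).measurableSet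

lemma abs_band_le {n : ℕ} (D e : (Fin n → ℝ) → ℝ) (t : ℝ) (y : Fin n → ℝ) :
    |band D e t y| ≤ 1 := by
  unfold band indicator
  split_ifs <;> simp

lemma band_of_mem {n : ℕ} {D e : (Fin n → ℝ) → ℝ} {t : ℝ} {y : Fin n → ℝ}
    (h : 16 * t ≤ D y) (h' : e y < 16 * t) : band D e t y = 1 :=
  indicator_of_mem (show y ∈ {y | 16 * t ≤ D y ∧ e y < 16 * t} from ⟨h, h'⟩) _

lemma mem_of_band_ne_zero {n : ℕ} {D e : (Fin n → ℝ) → ℝ} {t : ℝ} {y : Fin n → ℝ}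
    (h : band D e t y ≠ 0) : 16 * t ≤ D y ∧ e y < 16 * t :=
  mem_of_indicator_ne_zero (s := {y | 16 * t ≤ D y ∧ e y < 16 * t}) h

/-- Data for a telescoping decomposition `fs J - fs 0 = ∑ ψ_j * G_j` along the scales `R / 2^j`. -/
structure ScaleData (n : ℕ) (R A : ℝ) (ψ G fs : ℕ → (Fin n → ℝ) → ℝ) : Prop where
  R_pos : 0 < R
  nice_psi : ∀ j, Nice (ψ j)
  nice_G : ∀ j, Nice (G j)
  psi_support : ∀ j z, R / 2 ^ j < ‖z‖ → ψ j z = 0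
  psi_integral : ∀ j, ∫ z, |ψ j z| ≤ A
  telescope : ∀ j x, conv (ψ j) (G j) x = fs (j + 1) x - fs j x

lemma le_add_of_lipschitz {n : ℕ} {D : (Fin n → ℝ) → ℝ} (hD : LipschitzWith 1 D)
    (x y : Fin n → ℝ) : D x ≤ D y + ‖x - y‖ := by
  have := hD.le_add_mul x y
  simpa [dist_eq_norm] using this

lemma ScaleData.abs_sum_conv_band_le {n : ℕ} {R A : ℝ} {ψ G fs : ℕ → (Fin n → ℝ) → ℝ}
    (S : ScaleData n R A ψ G fs) {D e : (Fin n → ℝ) → ℝ} (hD : LipschitzWith 1 D)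
    (he : LipschitzWith 1 e) {B : ℝ} (hB : 0 ≤ B)
    (hG : ∀ j y, e y < 16 * (R / 2 ^ j) → |G j y| ≤ B)
    (hf : ∀ j x, e x < 15 * (R / 2 ^ j) → |fs j x| ≤ B ∧ |fs (j + 1) x| ≤ B)
    (J : ℕ) (x : Fin n → ℝ) :
    |∑ j ∈ Finset.range J, conv (ψ j) (fun y => band D e (R / 2 ^ j) y * G j y) x|
      ≤ (2 + 2 * A) * B := by
  have hA : 0 ≤ A := (integral_nonneg fun _ => abs_nonneg _).trans (S.psi_integral 0)
  have ht : ∀ j : ℕ, 0 < R / 2 ^ j := fun j => div_pos S.R_pos (by positivity)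
  set T : ℕ → ℝ := fun j => conv (ψ j) (fun y => band D e (R / 2 ^ j) y * G j y) x with hT
  set full : ℕ → Prop := fun j => 17 * (R / 2 ^ j) ≤ D x ∧ e x < 15 * (R / 2 ^ j) with hfull
  have hTB : ∀ j, |T j| ≤ A * B := by
    intro j
    refine (abs_conv_le (S.nice_psi j) (S.psi_support j) x (B := B) fun y _ => ?_).trans ?_
    · by_cases hb : band D e (R / 2 ^ j) y = 0
      · simpa [hb] using hB
      · rw [abs_mul]
        have := hG j y (mem_of_band_ne_zero hb).2
        nlinarith [abs_band_le D e (R / 2 ^ j) y, abs_nonneg (G j y),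
          abs_nonneg (band D e (R / 2 ^ j) y)]
    · gcongr
      exact S.psi_integral j
  have hTfull : ∀ j, full j → T j = fs (j + 1) x - fs j x := by
    intro j hj
    rw [← S.telescope j x]
    refine conv_congr (S.psi_support j) x fun y hy => ?_
    rw [band_of_mem, one_mul]
    · linarith [le_add_of_lipschitz hD x y, hj.1]
    · have := le_add_of_lipschitz he y x
      rw [norm_sub_rev] at this
      linarith [hj.2]
  have hTzero : ∀ j, D x < 15 * (R / 2 ^ j) ∨ 17 * (R / 2 ^ j) ≤ e x → T j = 0 := by
    intro j hj
    refine conv_eq_zero (S.psi_support j) x fun y hy => ?_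
    by_contra hne
    obtain ⟨h1, h2⟩ := mem_of_band_ne_zero (left_ne_zero_of_mul hne)
    rcases hj with h | h
    · have := le_add_of_lipschitz hD y x
      rw [norm_sub_rev] at this
      linarith
    · linarith [le_add_of_lipschitz he x y]
  set p : ℝ → ℕ → Prop := fun a j => 15 * (R / 2 ^ j) ≤ a ∧ a < 17 * (R / 2 ^ j) with hp
  have hcard : ∀ a, ∑ j ∈ (Finset.range J).filter (p a), A * B ≤ A * B := by
    intro a
    rw [Finset.sum_const, nsmul_eq_mul]
    have h1 : (((Finset.range J).filter (p a)).card : ℝ) ≤ 1 := 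
      Nat.cast_le_one.2 (card_transition_le_one S.R_pos J a)
    nlinarith [mul_nonneg hA hB]
  have hnot : |∑ j ∈ (Finset.range J).filter (fun j => ¬ full j), T j| ≤ 2 * (A * B) := by
    have h1 : ∀ j ∈ (Finset.range J).filter (fun j => ¬ full j),
        |T j| ≤ (if p (D x) j then A * B else 0) + (if p (e x) j then A * B else 0) := by
      intro j hj
      have hnf := (Finset.mem_filter.1 hj).2
      have hAB := mul_nonneg hA hB
      by_cases c1 : p (D x) j
      · rw [if_pos c1]
        split_ifs <;> linarith [hTB j]
      by_cases c2 : p (e x) j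
      · rw [if_neg c1, if_pos c2]
        linarith [hTB j]
      rw [if_neg c1, if_neg c2, hTzero j, abs_zero, add_zero]
      by_contra hcon
      push Not at hcon
      have d1 : 17 * (R / 2 ^ j) ≤ D x := by
        by_contra hd
        exact c1 ⟨hcon.1, not_le.1 hd⟩
      have d2 : e x < 15 * (R / 2 ^ j) := by
        by_contra hd
        exact c2 ⟨not_lt.1 hd, hcon.2⟩
      exact hnf ⟨d1, d2⟩
    calc |∑ j ∈ (Finset.range J).filter (fun j => ¬ full j), T j|
        ≤ ∑ j ∈ (Finset.range J).filter (fun j => ¬ full j), |T j| :=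
          Finset.abs_sum_le_sum_abs _ _
      _ ≤ ∑ j ∈ (Finset.range J).filter (fun j => ¬ full j),
            ((if p (D x) j then A * B else 0) + (if p (e x) j then A * B else 0)) :=
          Finset.sum_le_sum h1
      _ ≤ ∑ j ∈ Finset.range J,
            ((if p (D x) j then A * B else 0) + (if p (e x) j then A * B else 0)) := by
          refine Finset.sum_le_sum_of_subset_of_nonneg (Finset.filter_subset _ _) ?_
          intro j _ _
          have hAB := mul_nonneg hA hB
          split_ifs <;> linarith
      _ ≤ 2 * (A * B) := by
          rw [Finset.sum_add_distrib, ← Finset.sum_filter, ← Finset.sum_filter]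
          linarith [hcard (D x), hcard (e x)]
  have hfullsum : |∑ j ∈ (Finset.range J).filter full, T j| ≤ 2 * B := by
    rw [Finset.sum_congr rfl fun j hj => hTfull j (Finset.mem_filter.1 hj).2]
    refine abs_sum_telescope_le (fun j => fs j x) _ hB ?_ ?_
    · intro a ha b hb j haj hjb
      simp only [Finset.mem_filter, Finset.mem_range, hfull] at ha hb ⊢
      have h1 : R / 2 ^ j ≤ R / 2 ^ a := by
        have := S.R_pos
        gcongr
        norm_num
      have h2 : R / 2 ^ b ≤ R / 2 ^ j := by
        have := S.R_pos
        gcongr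
        norm_num
      exact ⟨by omega, by linarith, by linarith⟩
    · exact fun j hj => hf j x (Finset.mem_filter.1 hj).2.2
  rw [← Finset.sum_filter_add_sum_filter_not (Finset.range J) full]
  refine (abs_add_le _ _).trans ?_
  linarith

/-- The stopped sums remain bounded after insertion of a cutoff which is Lipschitz at the
scale given by `D`. -/
lemma ScaleData.abs_sum_conv_cutoff_le {n : ℕ} {R A : ℝ} {ψ G fs : ℕ → (Fin n → ℝ) → ℝ}
    (S : ScaleData n R A ψ G fs) {D e : (Fin n → ℝ) → ℝ} (hD : LipschitzWith 1 D)
    (he : LipschitzWith 1 e) {B : ℝ} (hB : 0 ≤ B)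
    (hG : ∀ j y, e y < 16 * (R / 2 ^ j) → |G j y| ≤ B)
    (hf : ∀ j x, e x < 15 * (R / 2 ^ j) → |fs j x| ≤ B ∧ |fs (j + 1) x| ≤ B)
    {η : (Fin n → ℝ) → ℝ} (hηm : Measurable η) (hη : ∀ y, |η y| ≤ 1) {L : ℝ} (hL : 0 ≤ L)
    (hηL : ∀ x y, ‖x - y‖ ≤ D x / 15 → |η y - η x| * D x ≤ L * ‖x - y‖)
    (J : ℕ) (x : Fin n → ℝ) :
    |∑ j ∈ Finset.range J, conv (ψ j) (fun y => η y * (band D e (R / 2 ^ j) y * G j y)) x|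
      ≤ (2 + 2 * A + A * L) * B := by
  have hA : 0 ≤ A := (integral_nonneg fun _ => abs_nonneg _).trans (S.psi_integral 0)
  have ht : ∀ j : ℕ, 0 < R / 2 ^ j := fun j => div_pos S.R_pos (by positivity)
  set g : ℕ → (Fin n → ℝ) → ℝ := fun j y => band D e (R / 2 ^ j) y * G j y with hg
  have hgn : ∀ j, Nice (g j) := fun j =>
    (S.nice_G j).mul_bdd (measurable_band hD.continuous he.continuous _) (abs_band_le D e _)
  have hdn : ∀ j, Nice fun y => (η y - η x) * g j y := fun j =>
    (hgn j).mul_bdd (hηm.sub_const _) (B := 2) fun y =>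
      (abs_sub (η y) (η x)).trans (by linarith [hη x, hη y])
  have hsplit : ∀ j, conv (ψ j) (fun y => η y * g j y) x =
      η x * conv (ψ j) (g j) x + conv (ψ j) (fun y => (η y - η x) * g j y) x := by
    intro j
    rw [← conv_const_mul_right, ← conv_add_right (S.nice_psi j) ((hgn j).const_mul _) (hdn j)]
    congr 1; ext y; ring
  have hcomm : ∀ j, |conv (ψ j) (fun y => (η y - η x) * g j y) x| ≤
      if 15 * (R / 2 ^ j) ≤ D x then A * B * L / D x * (R / 2 ^ j) else 0 := by
    intro j
    split_ifs with hj
    · have hDx : 0 < D x := by linarith [ht j]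
      refine (abs_conv_le (S.nice_psi j) (S.psi_support j) x
        (B := L * (R / 2 ^ j) / D x * B) fun y hy => ?_).trans ?_
      · have h1 : |η y - η x| ≤ L * (R / 2 ^ j) / D x := by
          rw [le_div_iff₀ hDx]
          exact (hηL x y (by linarith)).trans (by gcongr)
        have h2 : |g j y| ≤ B := by
          by_cases hb : band D e (R / 2 ^ j) y = 0
          · simpa [hg, hb] using hB
          · rw [hg]
            simp only [abs_mul]
            have := hG j y (mem_of_band_ne_zero hb).2
            nlinarith [abs_band_le D e (R / 2 ^ j) y, abs_nonneg (G j y),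
              abs_nonneg (band D e (R / 2 ^ j) y)]
        rw [abs_mul]
        exact mul_le_mul h1 h2 (abs_nonneg _) ((abs_nonneg _).trans h1)
      · calc (∫ z, |ψ j z|) * (L * (R / 2 ^ j) / D x * B)
            ≤ A * (L * (R / 2 ^ j) / D x * B) := by
              have := (ht j).le
              gcongr
              exact S.psi_integral j
          _ = A * B * L / D x * (R / 2 ^ j) := by ring
    · rw [conv_eq_zero (S.psi_support j) x, abs_zero]
      intro y hy
      by_contra hne
      obtain ⟨h1, -⟩ := mem_of_band_ne_zero (left_ne_zero_of_mul (right_ne_zero_of_mul hne))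
      have := le_add_of_lipschitz hD y x
      rw [norm_sub_rev] at this
      linarith
  have hcommsum : |∑ j ∈ Finset.range J, conv (ψ j) (fun y => (η y - η x) * g j y) x| ≤
      A * L * B := by
    refine (Finset.abs_sum_le_sum_abs _ _).trans
      ((Finset.sum_le_sum fun j _ => hcomm j).trans ?_)
    rw [← Finset.sum_filter, ← Finset.mul_sum]
    rcases le_or_gt (D x) 0 with hD0 | hD0
    · rw [Finset.filter_false_of_mem, Finset.sum_empty, mul_zero]
      · positivity
      · intro j _ h
        linarith [ht j]
    · calc A * B * L / D x * ∑ j ∈ (Finset.range J).filter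
            (fun j => 15 * (R / 2 ^ j) ≤ D x), R / 2 ^ j
          ≤ A * B * L / D x * (2 * (D x / 15)) := by
            gcongr
            refine sum_div_two_pow_le _ S.R_pos.le (by positivity) fun j hj => ?_
            linarith [(Finset.mem_filter.1 hj).2]
        _ = A * L * B * (2 / 15) := by field_simp
        _ ≤ A * L * B := by
            have : 0 ≤ A * L * B := by positivity
            linarith
  have hmain := S.abs_sum_conv_band_le hD he hB hG hf J x
  change |∑ j ∈ Finset.range J, conv (ψ j) (fun y => η y * g j y) x| ≤ _
  simp only [hsplit]
  rw [Finset.sum_add_distrib, ← Finset.mul_sum]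
  refine (abs_add_le _ _).trans ?_
  rw [abs_mul]
  have h1 := mul_le_mul (hη x) hmain (abs_nonneg _) zero_le_one
  linarith

/-! ### A Lipschitz partition of unity of Whitney type -/

/-- The tent function `max 0 (1 - |u|)`. -/
def tent (u : ℝ) : ℝ := max 0 (1 - |u|)

lemma tent_nonneg (u : ℝ) : 0 ≤ tent u := le_max_left _ _

lemma tent_le_one (u : ℝ) : tent u ≤ 1 :=
  max_le zero_le_one (by linarith [abs_nonneg u])

lemma tent_of_one_le {u : ℝ} (h : 1 ≤ |u|) : tent u = 0 := max_eq_left (by linarith)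

lemma abs_tent_sub_le (u v : ℝ) : |tent u - tent v| ≤ |u - v| := by
  refine (abs_max_sub_max_le_max 0 (1 - |u|) 0 (1 - |v|)).trans (max_le (by simp) ?_)
  rw [show 1 - |u| - (1 - |v|) = |v| - |u| by ring, abs_sub_comm u v]
  exact abs_abs_sub_abs_le _ _

lemma sum_tent {u : ℝ} {M : ℤ} (hu : |u| < M) : ∑ m ∈ Finset.Icc (-M) M, tent (u - m) = 1 := by
  obtain ⟨h1, h2⟩ := abs_lt.1 hu
  have hk1 : -M ≤ ⌊u⌋ := Int.le_floor.2 (by push_cast; exact h1.le)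
  have hk2 : ⌊u⌋ < M := Int.floor_lt.2 h2
  have hf0 := Int.floor_le u
  have hf1 := Int.lt_floor_add_one u
  have hsub : ({⌊u⌋, ⌊u⌋ + 1} : Finset ℤ) ⊆ Finset.Icc (-M) M := by
    intro m hm
    simp only [Finset.mem_insert, Finset.mem_singleton] at hm
    rw [Finset.mem_Icc]
    omega
  rw [← Finset.sum_subset hsub, Finset.sum_pair (by simp)]
  · have e1 : tent (u - ⌊u⌋) = 1 - (u - ⌊u⌋) := by
      rw [tent, abs_of_nonneg (by linarith), max_eq_right (by linarith)]
    have e2 : tent (u - (⌊u⌋ + 1 : ℤ)) = u - ⌊u⌋ := by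
      push_cast
      rw [tent, abs_of_nonpos (by linarith), max_eq_right (by linarith)]
      ring
    rw [e1, e2]; ring
  · intro m _ hm
    simp only [Finset.mem_insert, Finset.mem_singleton, not_or] at hm
    refine tent_of_one_le ?_
    rcases lt_or_gt_of_ne hm.1 with h | h
    · have : (m : ℝ) + 1 ≤ ⌊u⌋ := by exact_mod_cast h
      exact (by linarith : (1 : ℝ) ≤ u - m).trans (le_abs_self _)
    · have h3 : ⌊u⌋ + 1 < m := lt_of_le_of_ne h (Ne.symm hm.2)
      have : (⌊u⌋ : ℝ) + 1 + 1 ≤ m := by exact_mod_cast h3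
      exact (by linarith : (1 : ℝ) ≤ -(u - m)).trans (neg_le_abs _)

/-- The ramp rising from `0` at `1` to `1` at `2`. -/
def ramp (u : ℝ) : ℝ := max 0 (min 1 (u - 1))

lemma ramp_nonneg (u : ℝ) : 0 ≤ ramp u := le_max_left _ _

lemma ramp_le_one (u : ℝ) : ramp u ≤ 1 := max_le zero_le_one (min_le_left _ _)

lemma ramp_mono : Monotone ramp := fun _ _ h =>
  max_le_max le_rfl (min_le_min le_rfl (by linarith))

lemma ramp_of_le_one {u : ℝ} (h : u ≤ 1) : ramp u = 0 :=
  max_eq_left ((min_le_right _ _).trans (by linarith))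

lemma ramp_of_two_le {u : ℝ} (h : 2 ≤ u) : ramp u = 1 := by
  rw [ramp, min_eq_left (by linarith), max_eq_right zero_le_one]

lemma abs_ramp_sub_le (u v : ℝ) : |ramp u - ramp v| ≤ |u - v| := by
  refine (abs_max_sub_max_le_max 0 _ 0 _).trans (max_le (by simp) ?_)
  refine (abs_min_sub_min_le_max 1 (u - 1) 1 (v - 1)).trans (max_le (by simp) ?_)
  simp

lemma abs_mul_sub_mul_le {a b a' b' : ℝ} (ha : |a| ≤ 1) (hb' : |b'| ≤ 1) :
    |a * b - a' * b'| ≤ |a - a'| + |b - b'| := by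
  have e : a * b - a' * b' = (a - a') * b' + a * (b - b') := by ring
  rw [e]
  refine (abs_add_le _ _).trans ?_
  rw [abs_mul, abs_mul]
  nlinarith [abs_nonneg (a - a'), abs_nonneg (b - b')]

lemma abs_prod_sub_prod_le {ι : Type*} (s : Finset ι) (a b : ι → ℝ)
    (ha : ∀ i, 0 ≤ a i ∧ a i ≤ 1) (hb : ∀ i, 0 ≤ b i ∧ b i ≤ 1) :
    |∏ i ∈ s, a i - ∏ i ∈ s, b i| ≤ ∑ i ∈ s, |a i - b i| := by
  classical
  induction s using Finset.induction_on with
  | empty => simp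
  | insert i s hi ih =>
    rw [Finset.prod_insert hi, Finset.prod_insert hi, Finset.sum_insert hi]
    refine (abs_mul_sub_mul_le ?_ ?_).trans (add_le_add le_rfl ih)
    · rw [abs_of_nonneg (ha i).1]; exact (ha i).2
    · rw [abs_of_nonneg (Finset.prod_nonneg fun j _ => (hb j).1)]
      exact Finset.prod_le_one (fun j _ => (hb j).1) fun j _ => (hb j).2

section Cutoff

variable {n : ℕ}

/-- The product of tents of width `r / 8` centered at `(r / 8) m`. -/
def gridBump (r : ℝ) (m : Fin n → ℤ) (y : Fin n → ℝ) : ℝ := ∏ l, tent (8 * y l / r - m l)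

/-- The part of the `m`-th grid bump at scale `r` lying where `D` is comparable to `r`. -/
def whitney (D : (Fin n → ℝ) → ℝ) (r : ℝ) (m : Fin n → ℤ) (y : Fin n → ℝ) : ℝ :=
  (ramp (2 * D y / r) - ramp (D y / r)) * gridBump r m y

lemma gridBump_nonneg (r : ℝ) (m : Fin n → ℤ) (y : Fin n → ℝ) : 0 ≤ gridBump r m y :=
  Finset.prod_nonneg fun _ _ => tent_nonneg _

lemma gridBump_le_one (r : ℝ) (m : Fin n → ℤ) (y : Fin n → ℝ) : gridBump r m y ≤ 1 :=
  Finset.prod_le_one (fun _ _ => tent_nonneg _) fun _ _ => tent_le_one _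

lemma abs_gridBump_sub_le {r : ℝ} (hr : 0 < r) (m : Fin n → ℤ) (x y : Fin n → ℝ) :
    |gridBump r m x - gridBump r m y| ≤ 8 * n / r * ‖x - y‖ := by
  refine (abs_prod_sub_prod_le _ _ _ (fun _ => ⟨tent_nonneg _, tent_le_one _⟩)
    fun _ => ⟨tent_nonneg _, tent_le_one _⟩).trans ?_
  have h : ∀ l ∈ Finset.univ, |tent (8 * x l / r - m l) - tent (8 * y l / r - m l)| ≤
      8 / r * ‖x - y‖ := by
    intro l _
    refine (abs_tent_sub_le _ _).trans ?_
    have e : 8 * x l / r - m l - (8 * y l / r - m l) = 8 / r * (x - y) l := by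
      simp only [Pi.sub_apply]; ring
    rw [e, abs_mul, abs_of_pos (by positivity)]
    gcongr
    exact norm_le_pi_norm (x - y) l
  refine (Finset.sum_le_sum h).trans (le_of_eq ?_)
  simp
  ring

lemma sum_gridBump {r ρ : ℝ} (hr : 0 < r) {M : ℤ} (hM : 8 * ρ / r < M) {y : Fin n → ℝ}
    (hy : ‖y‖ ≤ ρ) :
    ∑ m ∈ Fintype.piFinset fun _ : Fin n => Finset.Icc (-M) M, gridBump r m y = 1 := by
  have h := Finset.prod_univ_sum (fun _ : Fin n => Finset.Icc (-M) M)
    fun l m => tent (8 * y l / r - m)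
  rw [Finset.prod_eq_one] at h
  · exact h.symm
  · intro l _
    refine sum_tent (lt_of_le_of_lt ?_ hM)
    rw [abs_div, abs_of_pos hr, abs_mul, abs_of_pos (by norm_num : (0 : ℝ) < 8)]
    gcongr
    exact (norm_le_pi_norm y l).trans hy

variable {D : (Fin n → ℝ) → ℝ} {r : ℝ} {m : Fin n → ℤ}

lemma measurable_whitney (hD : Continuous D) : Measurable (whitney D r m) := by
  refine Continuous.measurable ?_
  unfold whitney gridBump ramp tent
  fun_prop

lemma shell_mem (hr : 0 < r) {d : ℝ} (hd : 0 ≤ d) :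
    0 ≤ ramp (2 * d / r) - ramp (d / r) ∧ ramp (2 * d / r) - ramp (d / r) ≤ 1 := by
  constructor
  · rw [sub_nonneg]
    refine ramp_mono ?_
    gcongr
    linarith
  · linarith [ramp_le_one (2 * d / r), ramp_nonneg (d / r)]

lemma abs_whitney_le (hr : 0 < r) (hD0 : ∀ y, 0 ≤ D y) (y : Fin n → ℝ) :
    |whitney D r m y| ≤ 1 := by
  obtain ⟨h1, h2⟩ := shell_mem hr (hD0 y)
  rw [whitney, abs_mul, abs_of_nonneg h1, abs_of_nonneg (gridBump_nonneg _ _ _)]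
  exact mul_le_one₀ h2 (gridBump_nonneg _ _ _) (gridBump_le_one _ _ _)

lemma bounds_of_whitney_ne_zero (hr : 0 < r) {y : Fin n → ℝ} (h : whitney D r m y ≠ 0) :
    r / 2 < D y ∧ D y < 2 * r ∧ ‖y - fun l => r / 8 * m l‖ ≤ r / 8 := by
  have h1 := left_ne_zero_of_mul h
  have h2 := right_ne_zero_of_mul h
  refine ⟨?_, ?_, ?_⟩
  · by_contra hc
    push Not at hc
    apply h1
    rw [ramp_of_le_one, ramp_of_le_one, sub_zero]
    · rw [div_le_one hr]; linarith
    · rw [div_le_one hr]; linarith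
  · by_contra hc
    push Not at hc
    apply h1
    rw [ramp_of_two_le, ramp_of_two_le, sub_self]
    · rw [le_div_iff₀ hr]; linarith
    · rw [le_div_iff₀ hr]; linarith
  · refine (pi_norm_le_iff_of_nonneg (by positivity)).2 fun l => ?_
    by_contra hc
    push Not at hc
    refine h2 (Finset.prod_eq_zero (Finset.mem_univ l) (tent_of_one_le ?_))
    have e : 8 * y l / r - m l = 8 / r * (y l - r / 8 * m l) := by field_simp
    rw [e, abs_mul, abs_of_pos (by positivity)]
    rw [Real.norm_eq_abs, Pi.sub_apply] at hc
    rw [div_mul_eq_mul_div, one_le_div hr]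
    linarith

lemma abs_whitney_sub_le (hr : 0 < r) (hD0 : ∀ y, 0 ≤ D y) (hD : LipschitzWith 1 D)
    (x y : Fin n → ℝ) :
    |whitney D r m y - whitney D r m x| ≤ (3 + 8 * n) / r * ‖x - y‖ := by
  obtain ⟨h1, h2⟩ := shell_mem hr (hD0 y)
  refine (abs_mul_sub_mul_le (abs_le.2 ⟨by linarith, h2⟩) ?_).trans ?_
  · rw [abs_of_nonneg (gridBump_nonneg _ _ _)]
    exact gridBump_le_one _ _ _
  have hd : |D y - D x| ≤ ‖x - y‖ := by
    have := hD.dist_le_mul y x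
    rw [NNReal.coe_one, one_mul, Real.dist_eq, dist_eq_norm, norm_sub_rev] at this
    exact this
  have a1 : |ramp (2 * D y / r) - ramp (2 * D x / r)| ≤ 2 / r * ‖x - y‖ := by
    refine (abs_ramp_sub_le _ _).trans ?_
    have e : 2 * D y / r - 2 * D x / r = 2 / r * (D y - D x) := by ring
    rw [e, abs_mul, abs_of_pos (by positivity)]
    gcongr
  have a2 : |ramp (D y / r) - ramp (D x / r)| ≤ 1 / r * ‖x - y‖ := by
    refine (abs_ramp_sub_le _ _).trans ?_
    have e : D y / r - D x / r = 1 / r * (D y - D x) := by ring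
    rw [e, abs_mul, abs_of_pos (by positivity)]
    gcongr
  have a3 := abs_gridBump_sub_le hr m y x
  rw [norm_sub_rev y x] at a3
  have a4 : |ramp (2 * D y / r) - ramp (D y / r) - (ramp (2 * D x / r) - ramp (D x / r))| ≤
      2 / r * ‖x - y‖ + 1 / r * ‖x - y‖ := by
    rw [show ramp (2 * D y / r) - ramp (D y / r) - (ramp (2 * D x / r) - ramp (D x / r)) =
      (ramp (2 * D y / r) - ramp (2 * D x / r)) - (ramp (D y / r) - ramp (D x / r)) by ring]
    exact (abs_sub _ _).trans (add_le_add a1 a2)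
  refine (add_le_add a4 a3).trans (le_of_eq ?_)
  ring

lemma abs_whitney_sub_mul_le (hr : 0 < r) (hD0 : ∀ y, 0 ≤ D y) (hD : LipschitzWith 1 D)
    {x y : Fin n → ℝ} (hxy : ‖x - y‖ ≤ D x / 15) :
    |whitney D r m y - whitney D r m x| * D x ≤ 3 * (3 + 8 * n) * ‖x - y‖ := by
  by_cases hD3 : D x ≤ 3 * r
  · calc |whitney D r m y - whitney D r m x| * D x
        ≤ (3 + 8 * n) / r * ‖x - y‖ * (3 * r) := by
          have := hD0 x
          gcongr
          exact abs_whitney_sub_le hr hD0 hD x y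
      _ = 3 * (3 + 8 * n) * ‖x - y‖ := by field_simp
  · have hx : whitney D r m x = 0 := by
      by_contra hne
      have := (bounds_of_whitney_ne_zero hr hne).2.1
      linarith
    have hy : whitney D r m y = 0 := by
      by_contra hne
      have h1 := (bounds_of_whitney_ne_zero hr hne).2.1
      have h2 := le_add_of_lipschitz hD x y
      linarith
    rw [hx, hy, sub_self, abs_zero, zero_mul]
    positivity

/-- The Whitney cutoffs form a partition of unity. -/
lemma sum_whitney {r₀ ρ : ℝ} (hr₀ : 0 < r₀) {M : ℕ → ℤ} (hM : ∀ i, 8 * ρ / (r₀ / 2 ^ i) < M i)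
    {I : ℕ} {y : Fin n → ℝ} (hy : ‖y‖ ≤ ρ) (h1 : 2 * (r₀ / 2 ^ I) ≤ D y) (h2 : D y ≤ r₀) :
    ∑ i ∈ Finset.range I, ∑ m ∈ Fintype.piFinset fun _ : Fin n => Finset.Icc (-(M i)) (M i),
      whitney D (r₀ / 2 ^ i) m y = 1 := by
  have h : ∀ i ∈ Finset.range I,
      ∑ m ∈ Fintype.piFinset fun _ : Fin n => Finset.Icc (-(M i)) (M i),
        whitney D (r₀ / 2 ^ i) m y =
      ramp (D y / (r₀ / 2 ^ (i + 1))) - ramp (D y / (r₀ / 2 ^ i)) := by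
    intro i _
    simp only [whitney]
    rw [← Finset.mul_sum, sum_gridBump (by positivity) (hM i) hy, mul_one]
    congr 2
    rw [pow_succ]
    field_simp
  rw [Finset.sum_congr rfl h, Finset.sum_range_sub fun i => ramp (D y / (r₀ / 2 ^ i)),
    ramp_of_two_le, ramp_of_le_one, sub_zero]
  · rw [pow_zero, div_one, div_le_one hr₀]; exact h2
  · rw [le_div_iff₀ (by positivity)]; exact h1

end Cutoff

/-! ### Overlap counting -/

lemma card_scales_le {r₀ d : ℝ} (hr₀ : 0 < r₀) (S : Finset ℕ)
    (h : ∀ i ∈ S, r₀ / 2 ^ i / 8 ≤ d ∧ d ≤ 3 * (r₀ / 2 ^ i)) : S.card ≤ 5 := by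
  rcases S.eq_empty_or_nonempty with rfl | hne
  · simp
  have hsub : S ⊆ Finset.Ico (S.min' hne) (S.min' hne + 5) := by
    intro i hi
    rw [Finset.mem_Ico]
    refine ⟨S.min'_le i hi, ?_⟩
    by_contra hc
    push Not at hc
    have h1 := (h _ (S.min'_mem hne)).1
    have h2 := (h _ hi).2
    have h3 : r₀ / 2 ^ i ≤ r₀ / 2 ^ (S.min' hne + 5) := by
      gcongr
      norm_num
    have h4 : r₀ / 2 ^ (S.min' hne + 5) = r₀ / 2 ^ S.min' hne / 32 := by
      rw [pow_add, ← div_div]; norm_num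
    have h5 : 0 < r₀ / 2 ^ S.min' hne := by positivity
    linarith
  simpa using Finset.card_le_card hsub

lemma card_grid_le {n : ℕ} (u : Fin n → ℝ) (S : Finset (Fin n → ℤ))
    (h : ∀ m ∈ S, ∀ l, |u l - m l| ≤ 2) : S.card ≤ 5 ^ n := by
  have hsub : S ⊆ Fintype.piFinset fun l => Finset.Icc ⌈u l - 2⌉ ⌊u l + 2⌋ := by
    intro m hm
    refine Fintype.mem_piFinset.2 fun l => ?_
    have := abs_le.1 (h m hm l)
    exact Finset.mem_Icc.2 ⟨Int.ceil_le.2 (by linarith), Int.le_floor.2 (by linarith)⟩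
  refine (Finset.card_le_card hsub).trans ?_
  rw [Fintype.card_piFinset]
  refine (Finset.prod_le_pow_card _ _ 5 fun l _ => ?_).trans (by simp)
  rw [Int.card_Icc]
  have h1 := Int.floor_le (u l + 2)
  have h2 := Int.le_ceil (u l - 2)
  have h3 : (⌊u l + 2⌋ : ℝ) ≤ ⌈u l - 2⌉ + 4 := by linarith
  have h4 : ⌊u l + 2⌋ ≤ ⌈u l - 2⌉ + 4 := by exact_mod_cast h3
  omega

/-! ### Functions with finite atomic decompositions -/

/-- `f` is a finite combination `∑ λ_j a_j` of atoms supported in cubes `Q_j` such that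
`∑ λ_j χ_{Q_j} ≤ g`. -/
def HasDec {n : ℕ} (N : ℕ) (f g : (Fin n → ℝ) → ℝ) : Prop :=
  ∃ (L : ℕ) (lam : Fin L → ℝ) (a : Fin L → (Fin n → ℝ) → ℝ) (Q : Fin L → Cube n),
    (∀ j, 0 ≤ lam j) ∧ (∀ j, IsAtom N (a j) (Q j)) ∧ (∀ x, f x = ∑ j, lam j * a j x) ∧
    ∀ x, ∑ j, lam j * chi (Q j).set x ≤ g x

section HasDec

variable {n N : ℕ}

lemma HasDec.mono {f g f' g' : (Fin n → ℝ) → ℝ} (h : HasDec N f g) (hf : ∀ x, f' x = f x)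
    (hg : ∀ x, g x ≤ g' x) : HasDec N f' g' := by
  obtain ⟨L, lam, a, Q, h1, h2, h3, h4⟩ := h
  exact ⟨L, lam, a, Q, h1, h2, fun x => (hf x).trans (h3 x), fun x => (h4 x).trans (hg x)⟩

lemma HasDec.zero : HasDec N (fun _ : Fin n → ℝ => 0) fun _ => 0 :=
  ⟨0, Fin.elim0, Fin.elim0, Fin.elim0, fun j => j.elim0, fun j => j.elim0, by simp, by simp⟩

lemma HasDec.add {f g f' g' : (Fin n → ℝ) → ℝ} (h : HasDec N f g) (h' : HasDec N f' g') :
    HasDec N (fun x => f x + f' x) fun x => g x + g' x := by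
  obtain ⟨L, lam, a, Q, h1, h2, h3, h4⟩ := h
  obtain ⟨L', lam', a', Q', h1', h2', h3', h4'⟩ := h'
  refine ⟨L + L', Fin.append lam lam', Fin.append a a', Fin.append Q Q', fun j => ?_,
    fun j => ?_, fun x => ?_, fun x => ?_⟩
  · refine Fin.addCases (fun i => ?_) (fun i => ?_) j
    · simpa using h1 i
    · simpa using h1' i
  · refine Fin.addCases (fun i => ?_) (fun i => ?_) j
    · simpa using h2 i
    · simpa using h2' i
  · simp [Fin.sum_univ_add, h3, h3']
  · simpa [Fin.sum_univ_add] using add_le_add (h4 x) (h4' x)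

lemma HasDec.sum {ι : Type*} {s : Finset ι} {f g : ι → (Fin n → ℝ) → ℝ}
    (h : ∀ i ∈ s, HasDec N (f i) (g i)) :
    HasDec N (fun x => ∑ i ∈ s, f i x) fun x => ∑ i ∈ s, g i x := by
  classical
  induction s using Finset.induction_on with
  | empty => simpa using HasDec.zero
  | insert a s ha ih =>
    simp only [Finset.sum_insert ha]
    exact (h a (by simp)).add (ih fun i hi => h i (by simp [hi]))

lemma hasDec_of_nice {F : (Fin n → ℝ) → ℝ} (hF : Nice F) (hm : HasMoments N 0 F) (Q : Cube n)
    (hQ : ∀ x ∉ Q.set, F x = 0) {b : ℝ} (hb : ∀ x, |F x| ≤ b) :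
    HasDec N F fun x => b * chi Q.set x := by
  have hb0 : 0 ≤ b := (abs_nonneg _).trans (hb 0)
  refine ⟨1, fun _ => b, fun _ x => b⁻¹ * F x, fun _ => Q, fun _ => hb0, fun _ => ?_,
    fun x => ?_, fun x => by simp⟩
  · refine ⟨hF.1.const_mul _, fun x hx => by simp [hQ x hx],
      Filter.Eventually.of_forall fun x => ?_, fun β hβ => ?_⟩
    · rw [abs_mul, abs_of_nonneg (inv_nonneg.2 hb0)]
      rcases hb0.eq_or_lt with h | h
      · simp [← h]
      · rw [inv_mul_le_iff₀ h, mul_one]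
        exact hb x
    · have h0 : ∫ x, mono β x * F x = 0 := by simpa using hm β hβ
      have e : ∀ x : Fin n → ℝ, (∏ i, x i ^ β i) * (b⁻¹ * F x) = b⁻¹ * (mono β x * F x) :=
        fun x => by rw [mono]; ring
      simp only [e]
      rw [integral_const_mul, h0, mul_zero]
  · rcases hb0.eq_or_lt with h | h
    · have := hb x
      rw [← h] at this
      simp [abs_nonpos_iff.1 this, ← h]
    · simp [h.ne']

lemma HasMoments.sum_zero {ι : Type*} {s : Finset ι} {F : ι → (Fin n → ℝ) → ℝ}
    (h : ∀ i ∈ s, HasMoments N 0 (F i)) (hF : ∀ i ∈ s, Nice (F i)) :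
    HasMoments N 0 fun x => ∑ i ∈ s, F i x := by
  intro β hβ
  simp only [Finset.mul_sum]
  rw [integral_finsetSum _ fun i hi =>
    ((hF i hi).mul_continuous (continuous_mono β)).integrable _,
    Finset.sum_eq_zero fun i hi => by simpa using h i hi β hβ]
  simp

lemma HasMoments.conv_zero {a g : (Fin n → ℝ) → ℝ} (h : HasMoments N 0 a) (ha : Nice a)
    (hg : Nice g) : HasMoments N 0 (conv a g) := by
  intro β hβ
  rw [moment_conv h ha hg hβ]
  simp

lemma mem_cube_set_iff {Q : Cube n} {x : Fin n → ℝ} : x ∈ Q.set ↔ ‖x - Q.c‖ ≤ Q.h / 2 := by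
  rw [pi_norm_le_iff_of_nonneg (by linarith [Q.h_pos])]
  rfl

end HasDec

/-! ### Decomposition of stopped sums -/

section Stopped

variable {n N : ℕ} {R A : ℝ} {ψ G fs : ℕ → (Fin n → ℝ) → ℝ}

/-- The number of grid cubes at comparable scales meeting a point is bounded. -/
lemma sum_overlap_le {r₀ b d : ℝ} (hr₀ : 0 < r₀) (hb : 0 ≤ b) (s : Finset ℕ)
    (T : ℕ → Finset (Fin n → ℤ)) (v : ℕ → (Fin n → ℤ) → ℝ) (x : Fin n → ℝ)
    (hv : ∀ i m, v i m = 0 ∨ (v i m ≤ b ∧ (r₀ / 2 ^ i / 8 ≤ d ∧ d ≤ 3 * (r₀ / 2 ^ i)) ∧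
      ∀ l, |8 * x l / (r₀ / 2 ^ i) - m l| ≤ 2)) :
    ∑ i ∈ s, ∑ m ∈ T i, v i m ≤ if 0 < d then 5 * 5 ^ n * b else 0 := by
  classical
  have hinner : ∀ i ∈ s, ∑ m ∈ T i, v i m ≤
      if r₀ / 2 ^ i / 8 ≤ d ∧ d ≤ 3 * (r₀ / 2 ^ i) then 5 ^ n * b else 0 := by
    intro i _
    split_ifs with hd
    · calc ∑ m ∈ T i, v i m
          ≤ ∑ m ∈ T i, if ∀ l, |8 * x l / (r₀ / 2 ^ i) - m l| ≤ 2 then b else 0 := by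
            refine Finset.sum_le_sum fun m _ => ?_
            rcases hv i m with h | h
            · rw [h]; split_ifs <;> simp [hb]
            · rw [if_pos h.2.2]; exact h.1
        _ ≤ 5 ^ n * b := by
            rw [← Finset.sum_filter, Finset.sum_const, nsmul_eq_mul]
            gcongr
            exact_mod_cast card_grid_le (fun l => 8 * x l / (r₀ / 2 ^ i)) _ fun m hm =>
              (Finset.mem_filter.1 hm).2
    · refine (Finset.sum_eq_zero fun m _ => ?_).le
      rcases hv i m with h | h
      · exact h
      · exact absurd h.2.1 hd
  refine (Finset.sum_le_sum hinner).trans ?_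
  rw [← Finset.sum_filter, Finset.sum_const, nsmul_eq_mul]
  split_ifs with hd
  · rw [mul_assoc]
    gcongr
    exact_mod_cast card_scales_le (d := d) hr₀ _ fun i hi => (Finset.mem_filter.1 hi).2
  · rw [Finset.filter_false_of_mem]
    · simp
    · intro i _ h
      have : 0 < r₀ / 2 ^ i := by positivity
      linarith [h.1]

lemma ScaleData.hasDec_band (S : ScaleData n R A ψ G fs) (hψc : ∀ j, Continuous (ψ j))
    (hψm : ∀ j, HasMoments N 0 (ψ j)) {D e : (Fin n → ℝ) → ℝ} (hD : LipschitzWith 1 D)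
    (hD0 : ∀ y, 0 ≤ D y) (he : LipschitzWith 1 e) {B : ℝ} (hB : 0 ≤ B)
    (hG : ∀ j y, e y < 16 * (R / 2 ^ j) → |G j y| ≤ B)
    (hf : ∀ j x, e x < 15 * (R / 2 ^ j) → |fs j x| ≤ B ∧ |fs (j + 1) x| ≤ B)
    {ρ : ℝ} (hGρ : ∀ j y, ρ < ‖y‖ → G j y = 0) (hDρ : ∀ y, ‖y‖ ≤ ρ → D y ≤ 64 * R) (J : ℕ) :
    HasDec N
      (fun x => ∑ j ∈ Finset.range J, conv (ψ j) (fun y => band D e (R / 2 ^ j) y * G j y) x)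
      fun x => if 0 < D x then 5 * 5 ^ n * ((2 + 2 * A + A * (3 * (3 + 8 * n))) * B) else 0 := by
  classical
  have hR := S.R_pos
  have hA : 0 ≤ A := (integral_nonneg fun _ => abs_nonneg _).trans (S.psi_integral 0)
  set b := (2 + 2 * A + A * (3 * (3 + 8 * (n : ℝ)))) * B with hbdef
  have hb : 0 ≤ b := by positivity
  set r : ℕ → ℝ := fun i => 64 * R / 2 ^ i with hr
  have hr0 : ∀ i, 0 < r i := fun i => by positivity
  choose M hM using fun i => exists_nat_gt (8 * ρ / r i)
  set T : ℕ → Finset (Fin n → ℤ) := fun i =>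
    Fintype.piFinset fun _ : Fin n => Finset.Icc (-(M i : ℤ)) (M i) with hT
  set g : ℕ → (Fin n → ℝ) → ℝ := fun j y => band D e (R / 2 ^ j) y * G j y with hg
  have hgn : ∀ j, Nice (g j) := fun j =>
    (S.nice_G j).mul_bdd (measurable_band hD.continuous he.continuous _) (abs_band_le D e _)
  have hwn : ∀ i m j, Nice fun y => whitney D (r i) m y * g j y := fun i m j =>
    (hgn j).mul_bdd (measurable_whitney hD.continuous) (abs_whitney_le (hr0 i) hD0)
  set F : ℕ → (Fin n → ℤ) → (Fin n → ℝ) → ℝ := fun i m x =>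
    ∑ j ∈ Finset.range J, conv (ψ j) (fun y => whitney D (r i) m y * g j y) x with hF
  have hFn : ∀ i m, Nice (F i m) := fun i m =>
    Nice.sum fun j _ => (S.nice_psi j).conv (hψc j) (hwn i m j)
  have hFm : ∀ i m, HasMoments N 0 (F i m) := fun i m =>
    HasMoments.sum_zero (fun j _ => (hψm j).conv_zero (S.nice_psi j) (hwn i m j))
      fun j _ => (S.nice_psi j).conv (hψc j) (hwn i m j)
  have hFb : ∀ i m x, |F i m x| ≤ b := fun i m x =>
    S.abs_sum_conv_cutoff_le hD he hB hG hf (measurable_whitney hD.continuous)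
      (abs_whitney_le (hr0 i) hD0) (by positivity)
      (fun x y => abs_whitney_sub_mul_le (hr0 i) hD0 hD) J x
  set Q : ℕ → (Fin n → ℤ) → Cube n := fun i m =>
    ⟨fun l => r i / 8 * m l, r i / 2, by linarith [hr0 i]⟩ with hQ
  have hFx : ∀ i m x, F i m x ≠ 0 → x ∈ (Q i m).set ∧
      ∃ y, D y < 2 * r i ∧ r i / 2 < D y ∧ ‖y - (Q i m).c‖ ≤ r i / 8 := by
    intro i m x hx
    obtain ⟨j, -, hj⟩ := Finset.exists_ne_zero_of_sum_ne_zero hx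
    obtain ⟨y, hxy, hy⟩ : ∃ y, ‖x - y‖ ≤ R / 2 ^ j ∧ whitney D (r i) m y * g j y ≠ 0 := by
      by_contra hc
      push Not at hc
      exact hj (conv_eq_zero (S.psi_support j) x hc)
    obtain ⟨h1, h2, h3⟩ := bounds_of_whitney_ne_zero (hr0 i) (left_ne_zero_of_mul hy)
    have h4 := (mem_of_band_ne_zero (left_ne_zero_of_mul (right_ne_zero_of_mul hy))).1
    refine ⟨mem_cube_set_iff.2 ?_, y, h2, h1, h3⟩
    have h5 := norm_sub_le_norm_sub_add_norm_sub x y (Q i m).c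
    change ‖y - (Q i m).c‖ ≤ r i / 8 at h3
    change _ ≤ r i / 2 / 2
    linarith
  have hdec : ∀ i m, HasDec N (F i m)
      fun x => if ∃ z, F i m z ≠ 0 then b * chi (Q i m).set x else 0 := by
    intro i m
    by_cases hz : ∃ z, F i m z ≠ 0
    · simp only [if_pos hz]
      refine hasDec_of_nice (hFn i m) (hFm i m) (Q i m) (fun x hx => ?_) (hFb i m)
      by_contra hne
      exact hx (hFx i m x hne).1
    · simp only [if_neg hz]
      push Not at hz
      exact HasDec.zero.mono hz fun _ => le_rfl
  refine (HasDec.sum (s := Finset.range (J + 6)) fun i _ =>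
    HasDec.sum (s := T i) fun m _ => hdec i m).mono (fun x => ?_) fun x => ?_
  · have h1 : ∀ j ∈ Finset.range J, conv (ψ j) (g j) x = ∑ i ∈ Finset.range (J + 6),
        ∑ m ∈ T i, conv (ψ j) (fun y => whitney D (r i) m y * g j y) x := by
      intro j hj
      have h2 : g j = fun y => ∑ i ∈ Finset.range (J + 6), ∑ m ∈ T i,
          whitney D (r i) m y * g j y := by
        ext y
        by_cases h0 : g j y = 0
        · simp [h0]
        simp only [← Finset.sum_mul]
        have hy : ‖y‖ ≤ ρ := by
          by_contra hc
          exact h0 (by simp [hg, hGρ j y (not_le.1 hc)])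
        have h4 := (mem_of_band_ne_zero (left_ne_zero_of_mul h0)).1
        rw [sum_whitney (r₀ := 64 * R) (M := fun i => (M i : ℤ)) (by positivity)
          (fun i => by simpa [hr] using hM i) hy ?_ (hDρ y hy), one_mul]
        have h5 : R / 2 ^ J ≤ R / 2 ^ j := by
          gcongr
          · norm_num
          · exact (Finset.mem_range.1 hj).le
        have h6 : 64 * R / 2 ^ (J + 6) = R / 2 ^ J := by
          rw [pow_add]
          field_simp
          norm_num
        have h7 : 0 < R / 2 ^ j := by positivity
        rw [h6]
        linarith
      conv_lhs => rw [h2]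
      rw [conv_sum_right (S.nice_psi j) fun i _ => Nice.sum fun m _ => hwn i m j]
      exact Finset.sum_congr rfl fun i _ => conv_sum_right (S.nice_psi j) (fun m _ => hwn i m j) x
    change ∑ j ∈ Finset.range J, conv (ψ j) (g j) x = _
    rw [Finset.sum_congr rfl h1, Finset.sum_comm]
    refine Finset.sum_congr rfl fun i _ => ?_
    rw [Finset.sum_comm]
  · refine sum_overlap_le (r₀ := 64 * R) (by positivity) hb _ _ _ x fun i m => ?_
    by_cases hz : ∃ z, F i m z ≠ 0
    · rw [if_pos hz]
      by_cases hx : x ∈ (Q i m).set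
      · right
        obtain ⟨z, hz⟩ := hz
        obtain ⟨-, y, h1, h2, h3⟩ := hFx i m z hz
        have h4 := mem_cube_set_iff.1 hx
        change _ ≤ r i / 2 / 2 at h4
        have h5 : ‖x - y‖ ≤ r i / 4 + r i / 8 := by
          have := norm_sub_le_norm_sub_add_norm_sub x (Q i m).c y
          rw [norm_sub_rev (Q i m).c y] at this
          linarith
        have h6 := le_add_of_lipschitz hD x y
        have h7 := le_add_of_lipschitz hD y x
        rw [norm_sub_rev] at h7
        have h8 := hr0 i
        refine ⟨?_, ⟨?_, ?_⟩, fun l => ?_⟩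
        · simp [chi, hx]
        · change r i / 8 ≤ _
          linarith
        · change _ ≤ 3 * r i
          linarith
        · have h9 := hx l
          change |x l - r i / 8 * m l| ≤ r i / 2 / 2 at h9
          change |8 * x l / r i - m l| ≤ 2
          have e : 8 * x l / r i - m l = 8 / r i * (x l - r i / 8 * m l) := by field_simp
          rw [e, abs_mul, abs_of_pos (by positivity), div_mul_eq_mul_div, div_le_iff₀ h8]
          linarith
      · left
        simp [chi, hx]
    · left
      rw [if_neg hz]

end Stopped

section Levels

variable {n N : ℕ} {R A : ℝ} {ψ G fs : ℕ → (Fin n → ℝ) → ℝ}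

lemma abs_le_of_infDist_lt {h : ℕ → (Fin n → ℝ) → ℝ} {s : ℝ} {E : Set (Fin n → ℝ)}
    (hE : E.Nonempty) (hs : ∀ z ∈ E, ∀ j y, ‖y - z‖ ≤ 40 * (R / 2 ^ j) → |h j y| ≤ s)
    {j : ℕ} {y : Fin n → ℝ} (hy : Metric.infDist y E < 40 * (R / 2 ^ j)) : |h j y| ≤ s := by
  obtain ⟨z, hz, hyz⟩ := (Metric.infDist_lt_iff hE).1 hy
  exact hs z hz j y (by rw [← dist_eq_norm]; exact hyz.le)

lemma sum_band {D : (Fin n → ℝ) → ℝ} {e : ℕ → (Fin n → ℝ) → ℝ} {t : ℝ} (ht : 0 < t)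
    (he : ∀ k y, e (k + 1) y ≤ e k y) {K : ℕ} (hK : ∀ y, e K y = 0) (y : Fin n → ℝ)
    (hD : 16 * t ≤ D y) :
    band D (e 0) t y + ∑ k ∈ Finset.range K, band (e k) (e (k + 1)) t y = 1 := by
  set a : ℕ → ℝ := fun k => if 16 * t ≤ e k y then 0 else 1 with ha
  have h0 : band D (e 0) t y = a 0 := by
    simp only [band, indicator, mem_ofPred_eq, ha, ← not_le]
    split_ifs <;> tauto
  have h1 : ∀ k ∈ Finset.range K, band (e k) (e (k + 1)) t y = a (k + 1) - a k := by
    intro k _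
    have := he k y
    simp only [band, indicator, mem_ofPred_eq, ha, ← not_le]
    split_ifs <;> first | (exfalso; linarith) | (exfalso; tauto) | norm_num
  rw [h0, Finset.sum_congr rfl h1, Finset.sum_range_sub]
  have h2 : a K = 1 := by
    simp only [ha, hK]
    rw [if_neg (by linarith)]
  rw [h2]
  ring

/-- Decomposition of a telescoping sum along a decreasing family of distance functions. -/
lemma ScaleData.hasDec_levels (S : ScaleData n R A ψ G fs) (hψc : ∀ j, Continuous (ψ j))
    (hψm : ∀ j, HasMoments N 0 (ψ j)) (hGρ : ∀ j y, 2 * R < ‖y‖ → G j y = 0)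
    {e : ℕ → (Fin n → ℝ) → ℝ} (he : ∀ k, LipschitzWith 1 (e k)) (he0 : ∀ k y, 0 ≤ e k y)
    (hanti : ∀ k y, e (k + 1) y ≤ e k y) {K : ℕ} (hK : ∀ y, e K y = 0)
    (heR : ∀ k y, ‖y‖ ≤ 2 * R → e k y ≤ 64 * R) {B : ℕ → ℝ} (hB : ∀ k, 0 ≤ B k)
    (hG : ∀ k j y, e k y < 16 * (R / 2 ^ j) → |G j y| ≤ B k)
    (hf : ∀ k j x, e k x < 15 * (R / 2 ^ j) → |fs j x| ≤ B k ∧ |fs (j + 1) x| ≤ B k)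
    {Q : Cube n} (hQ : ∀ x ∉ Q.set, 3 * R < ‖x‖) (J : ℕ) :
    HasDec N (fun x => fs J x - fs 0 x) fun x => (2 + 2 * A) * B 0 * chi Q.set x +
      ∑ k ∈ Finset.range K, if 0 < e k x then
        5 * 5 ^ n * ((2 + 2 * A + A * (3 * (3 + 8 * n))) * B (k + 1)) else 0 := by
  have hR := S.R_pos
  have htR : ∀ j : ℕ, R / 2 ^ j ≤ R := fun j => div_le_self hR.le (one_le_pow₀ (by norm_num))
  have ht : ∀ j : ℕ, 0 < R / 2 ^ j := fun j => by positivity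
  set D : (Fin n → ℝ) → ℝ := fun _ => 17 * R
  have hD : LipschitzWith 1 D := LipschitzWith.const' _
  have hbn : ∀ {D' e' : (Fin n → ℝ) → ℝ}, LipschitzWith 1 D' → LipschitzWith 1 e' → ∀ j,
      Nice fun y => band D' e' (R / 2 ^ j) y * G j y := fun h h' j =>
    (S.nice_G j).mul_bdd (measurable_band h.continuous h'.continuous _) (abs_band_le _ _ _)
  have hbase : HasDec N (fun x => ∑ j ∈ Finset.range J,
      conv (ψ j) (fun y => band D (e 0) (R / 2 ^ j) y * G j y) x)
      fun x => (2 + 2 * A) * B 0 * chi Q.set x := by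
    refine hasDec_of_nice (Nice.sum fun j _ => (S.nice_psi j).conv (hψc j) (hbn hD (he 0) j))
      (HasMoments.sum_zero (fun j _ => (hψm j).conv_zero (S.nice_psi j) (hbn hD (he 0) j))
        fun j _ => (S.nice_psi j).conv (hψc j) (hbn hD (he 0) j)) Q (fun x hx => ?_)
      (S.abs_sum_conv_band_le hD (he 0) (hB 0) (hG 0) (hf 0) J)
    refine Finset.sum_eq_zero fun j _ => ?_
    refine conv_support (r' := 2 * R) (S.psi_support j) (fun y hy => ?_) x ?_
    · rw [hGρ j y hy, mul_zero]
    · linarith [htR j, hQ x hx]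
  refine (hbase.add (HasDec.sum (s := Finset.range K) fun k _ =>
    S.hasDec_band hψc hψm (he k) (he0 k) (he (k + 1)) (hB (k + 1)) (hG (k + 1)) (hf (k + 1))
      hGρ (heR k) J)).mono (fun x => ?_) fun x => le_rfl
  rw [Finset.sum_comm, ← Finset.sum_add_distrib, ← Finset.sum_range_sub (fun j => fs j x)]
  refine Finset.sum_congr rfl fun j _ => ?_
  rw [← S.telescope j x, ← conv_sum_right (S.nice_psi j) fun k _ => hbn (he k) (he (k + 1)) j,
    ← conv_add_right (S.nice_psi j) (hbn hD (he 0) j)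
      (Nice.sum fun k _ => hbn (he k) (he (k + 1)) j)]
  congr 1; ext y
  rw [← Finset.sum_mul, ← add_mul, sum_band (ht j) hanti hK y (by linarith [htR j]), one_mul]

end Levels

/-! ### Approximation by convolutions -/

section Approx

variable {n N : ℕ}

lemma abs_conv_sub_le {a f : (Fin n → ℝ) → ℝ} (ha : Nice a) (hf : Nice f)
    (h1 : ∫ z, a z = 1) {r ε : ℝ} (hr : ∀ z, r < ‖z‖ → a z = 0) (x : Fin n → ℝ)
    (hε : ∀ y, ‖x - y‖ ≤ r → |f y - f x| ≤ ε) : |conv a f x - f x| ≤ (∫ z, |a z|) * ε := by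
  have e : conv a f x - f x = conv a (fun y => f y - f x) x := by
    simp only [conv, mul_sub]
    rw [integral_sub (ha.conv_integrable hf x)
      (((ha.comp_sub_left x).integrable volume).mul_const _), integral_mul_const,
      integral_sub_left_eq_self a volume x, h1, one_mul]
  rw [e]
  exact abs_conv_le ha hr x hε

lemma abs_conv_conv_sub_le {a f : (Fin n → ℝ) → ℝ} (ha : Nice a) (hac : Continuous a)
    (hf : Nice f) (h1 : ∫ z, a z = 1) {r ε : ℝ} (hr : ∀ z, r < ‖z‖ → a z = 0)
    (hε : ∀ x y, ‖x - y‖ ≤ r → |f y - f x| ≤ ε) (x : Fin n → ℝ) :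
    |f x - conv a (conv a f) x| ≤ ((∫ z, |a z|) ^ 2 + ∫ z, |a z|) * ε := by
  have h2 : ∀ y, |conv a f y - f y| ≤ (∫ z, |a z|) * ε := fun y =>
    abs_conv_sub_le ha hf h1 hr y (hε y)
  have h3 : conv a (conv a f) x - conv a f x = conv a (fun y => conv a f y - f y) x := by
    simp only [conv, mul_sub]
    exact (integral_sub (ha.conv_integrable (ha.conv hac hf) x) (ha.conv_integrable hf x)).symm
  have h4 : |conv a (conv a f) x - conv a f x| ≤ (∫ z, |a z|) * ((∫ z, |a z|) * ε) := by
    rw [h3]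
    exact abs_conv_le ha hr x fun y _ => h2 y
  have e : f x - conv a (conv a f) x =
      -((conv a (conv a f) x - conv a f x) + (conv a f x - f x)) := by ring
  rw [e, abs_neg]
  refine (abs_add_le _ _).trans ((add_le_add h4 (h2 x)).trans (le_of_eq ?_))
  ring

/-- A nonzero function with compact support has grand maximal function bounded below on each
ball. -/
lemma exists_le_grandMax (N₀ : ℕ) {f : (Fin n → ℝ) → ℝ} (hf : ContDiff ℝ (⊤ : ℕ∞) f)
    (hc : HasCompactSupport f) (h0 : ∃ x, f x ≠ 0) {κ : ℝ} (hκ : 0 ≤ κ) :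
    ∃ μ : ℝ, 0 < μ ∧ ∀ z : Fin n → ℝ, ‖z‖ ≤ κ → ENNReal.ofReal μ ≤ grandMax n N₀ f z := by
  have hneg : ContDiff ℝ (⊤ : ℕ∞) fun x : Fin n → ℝ => f (-x) := hf.comp contDiff_neg
  have hcneg : HasCompactSupport fun x : Fin n → ℝ => f (-x) :=
    hc.comp_homeomorph (Homeomorph.neg _)
  obtain ⟨C, hC, h⟩ := conv_le_grandMax n N₀ hneg hcneg hκ
  obtain ⟨x, hx⟩ := h0
  have hI : 0 < ∫ y, f y * f y := by
    have hcont : Continuous fun y => f y * f y := hf.continuous.mul hf.continuous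
    exact hcont.integral_pos_of_hasCompactSupport_nonneg_nonzero hc.mul_left
      (fun y => mul_self_nonneg _) (x := x) (mul_self_ne_zero.2 hx)
  refine ⟨(∫ y, f y * f y) / C, by positivity, fun z hz => ?_⟩
  have h1 := h f 1 0 z one_pos (by simpa using hz)
  have e : conv (dil 1 fun x => f (-x)) f 0 = ∫ y, f y * f y := by
    simp [conv, dil]
  rw [e, abs_of_pos hI] at h1
  rw [ENNReal.ofReal_div_of_pos hC]
  exact ENNReal.div_le_of_le_mul' h1

end Approx

section Main

variable {n N : ℕ}

lemma scaleData_dil {φ f : (Fin n → ℝ) → ℝ} (hφ : Continuous φ)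
    (hs : ∀ z, 1 < ‖z‖ → φ z = 0) (hf : Nice f) {R : ℝ} (hR : 0 < R) :
    ScaleData n R (2 * ∫ z, |φ z|)
      (fun j z => dil (R / 2 ^ (j + 1)) φ z - dil (R / 2 ^ j) φ z)
      (fun j y => conv (dil (R / 2 ^ (j + 1)) φ) f y + conv (dil (R / 2 ^ j) φ) f y)
      fun j => conv (dil (R / 2 ^ j) φ) (conv (dil (R / 2 ^ j) φ) f) := by
  have ht : ∀ j : ℕ, 0 < R / 2 ^ j := fun j => by positivity
  have hc : ∀ j : ℕ, Continuous (dil (R / 2 ^ j) φ) := fun j => continuous_dil hφ _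
  have hsj : ∀ j : ℕ, ∀ z, R / 2 ^ j < ‖z‖ → dil (R / 2 ^ j) φ z = 0 := fun j =>
    dil_support (ht j) hs
  have hN : ∀ j : ℕ, Nice (dil (R / 2 ^ j) φ) := fun j => nice_of_continuous (hc j) (hsj j)
  have hh : ∀ j : ℕ, Nice (conv (dil (R / 2 ^ j) φ) f) := fun j => (hN j).conv (hc j) hf
  refine ⟨hR, fun j => (hN (j + 1)).sub (hN j), fun j => (hh (j + 1)).add (hh j),
    fun j z hz => ?_, fun j => ?_, fun j x => ?_⟩
  · have h1 := div_two_pow_succ_le hR.le (Nat.lt_add_one j)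
    have h2 := ht (j + 1)
    rw [hsj j z hz, hsj (j + 1) z (by linarith), sub_zero]
  · calc ∫ z, |dil (R / 2 ^ (j + 1)) φ z - dil (R / 2 ^ j) φ z|
        ≤ ∫ z, (|dil (R / 2 ^ (j + 1)) φ z| + |dil (R / 2 ^ j) φ z|) :=
          integral_mono (((hN (j + 1)).sub (hN j)).integrable _).abs
            (((hN (j + 1)).integrable _).abs.add ((hN j).integrable _).abs) fun z => abs_sub _ _
      _ = 2 * ∫ z, |φ z| := by
          rw [integral_add ((hN (j + 1)).integrable _).abs ((hN j).integrable _).abs,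
            integral_abs_dil φ (ht _), integral_abs_dil φ (ht _)]
          ring
  · rw [conv_sub_left (hN (j + 1)) (hN j) ((hh (j + 1)).add (hh j)),
      conv_add_right (hN (j + 1)) (hh (j + 1)) (hh j),
      conv_add_right (hN j) (hh (j + 1)) (hh j),
      conv_left_comm (hN (j + 1)) (hN j) hf]
    ring

/-- The points at which the averages `h_j` are bounded by `s` in a cone. -/
def levelSet (R : ℝ) (h : ℕ → (Fin n → ℝ) → ℝ) (s : ℝ) : Set (Fin n → ℝ) :=
  {z | ∀ j y, ‖y - z‖ ≤ 40 * (R / 2 ^ j) → |h j y| ≤ s}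

lemma levelSet_mono (R : ℝ) (h : ℕ → (Fin n → ℝ) → ℝ) {s s' : ℝ} (hs : s ≤ s') :
    levelSet R h s ⊆ levelSet R h s' := fun _ hz j y hy => (hz j y hy).trans hs

/-- Smooth compactly supported functions with vanishing moments, decomposed at heights
starting from `s₀`. -/
lemma exists_hasDec_levels (hn : 1 ≤ n) {φ f : (Fin n → ℝ) → ℝ} (hφ : Continuous φ)
    (hs : ∀ z, 1 < ‖z‖ → φ z = 0) (hm : HasMoments N 1 φ) (hfc : Continuous f)
    (hfm : HasMoments N 0 f) {R : ℝ} (hR : 0 < R) (hfR : ∀ y, R < ‖y‖ → f y = 0) {s₀ : ℝ}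
    (hs₀ : 0 < s₀) (h0 : ∀ y, (∫ z, |φ z|) * |conv (dil R φ) f y| ≤ s₀) :
    ∃ (K : ℕ) (e : ℕ → (Fin n → ℝ) → ℝ) (Q : Cube n), (∀ x ∈ Q.set, ‖x‖ ≤ 3 * R) ∧
      (∀ k x, 0 < e k x → ∃ j y, ‖y - x‖ ≤ 40 * (R / 2 ^ j) ∧
        s₀ * 2 ^ k ≤ |conv (dil (R / 2 ^ j) φ) f y|) ∧
      HasDec N f fun x =>
        (2 + (2 + 4 * ∫ z, |φ z|) * (2 + ∫ z, |φ z|)) * s₀ * chi Q.set x +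
        5 * 5 ^ n * ((2 + 4 * (∫ z, |φ z|) + 2 * (∫ z, |φ z|) * (3 * (3 + 8 * n))) *
          (2 + ∫ z, |φ z|)) * 2 * ∑ k ∈ (Finset.range K).filter (fun k => 0 < e k x),
            s₀ * 2 ^ k := by
  set A := ∫ z, |φ z| with hAdef
  have hA : 0 ≤ A := integral_nonneg fun _ => abs_nonneg _
  have hf : Nice f := nice_of_continuous hfc hfR
  have S : ScaleData n R (2 * A) _ _ _ := scaleData_dil hφ hs hf hR
  have ht : ∀ j : ℕ, 0 < R / 2 ^ j := fun j => by positivity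
  have htR : ∀ j : ℕ, R / 2 ^ j ≤ R := fun j => div_le_self hR.le (one_le_pow₀ (by norm_num))
  have hc : ∀ j : ℕ, Continuous (dil (R / 2 ^ j) φ) := fun j => continuous_dil hφ _
  have hsj : ∀ j : ℕ, ∀ z, R / 2 ^ j < ‖z‖ → dil (R / 2 ^ j) φ z = 0 := fun j =>
    dil_support (ht j) hs
  have hNφ : ∀ j : ℕ, Nice (dil (R / 2 ^ j) φ) := fun j => nice_of_continuous (hc j) (hsj j)
  have hmφ : ∀ j : ℕ, HasMoments N 1 (dil (R / 2 ^ j) φ) := fun j => hm.dil (ht j)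
  have hAj : ∀ j : ℕ, ∫ z, |dil (R / 2 ^ j) φ z| = A := fun j => integral_abs_dil φ (ht j)
  set h : ℕ → (Fin n → ℝ) → ℝ := fun j => conv (dil (R / 2 ^ j) φ) f with hh
  have hhN : ∀ j, Nice (h j) := fun j => (hNφ j).conv (hc j) hf
  have hhR : ∀ j y, 2 * R < ‖y‖ → h j y = 0 := fun j y hy =>
    conv_support (hsj j) hfR y (by linarith [htR j])
  set fs : ℕ → (Fin n → ℝ) → ℝ := fun j => conv (dil (R / 2 ^ j) φ) (h j) with hfs
  have hfsN : ∀ j, Nice (fs j) := fun j => (hNφ j).conv (hc j) (hhN j)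
  have hfsR : ∀ j y, 3 * R < ‖y‖ → fs j y = 0 := fun j y hy =>
    conv_support (hsj j) (hhR j) y (by linarith [htR j])
  have hfsm : ∀ j, HasMoments N 0 (fs j) := by
    intro j β hβ
    rw [moment_conv (hmφ j) (hNφ j) (hhN j) hβ, moment_conv (hmφ j) (hNφ j) hf hβ, hfm β hβ]
    simp
  obtain ⟨bf, hbf⟩ := hf.2.1
  obtain ⟨K, hK⟩ := pow_unbounded_of_one_lt (A * bf / s₀) (one_lt_two : (1 : ℝ) < 2)
  set E : ℕ → Set (Fin n → ℝ) := fun k => levelSet R h (s₀ * 2 ^ k) with hE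
  have hE0 : ∀ k, (fun _ => 43 * R) ∈ E k := by
    intro k j y hy
    have : Nonempty (Fin n) := ⟨⟨0, hn⟩⟩
    have h1 : ‖(fun _ => 43 * R : Fin n → ℝ)‖ = 43 * R := by
      rw [pi_norm_const, Real.norm_of_nonneg (by positivity)]
    have h2 := norm_sub_norm_le (fun _ => 43 * R : Fin n → ℝ) y
    rw [norm_sub_rev] at h2
    rw [hhR j y (by linarith [htR j]), abs_zero]
    positivity
  have hEK : E K = univ := by
    refine eq_univ_of_forall fun z j y _ => ?_
    rw [div_lt_iff₀ hs₀] at hK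
    have := abs_conv_le (hNφ j) (hsj j) y fun y _ => hbf y
    rw [hAj] at this
    linarith
  have hEmono : ∀ k, E k ⊆ E (k + 1) := fun k =>
    levelSet_mono R h (by gcongr <;> norm_num)
  set e : ℕ → (Fin n → ℝ) → ℝ := fun k y => Metric.infDist y (E k) with he
  have hle : ∀ k j y, e k y < 40 * (R / 2 ^ j) → |h j y| ≤ s₀ * 2 ^ k := fun k j y hy =>
    abs_le_of_infDist_lt ⟨_, hE0 k⟩ (fun z hz => hz) hy
  have hhalf : ∀ j : ℕ, R / 2 ^ (j + 1) = R / 2 ^ j / 2 := fun j => by rw [pow_succ, div_div]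
  have helip : ∀ k, LipschitzWith 1 (e k) := fun k => Metric.lipschitz_infDist_pt _
  have hfsle : ∀ k j x, e k x < 35 * (R / 2 ^ j) → |fs j x| ≤ A * (s₀ * 2 ^ k) := by
    intro k j x hx
    rw [← hAj j]
    refine abs_conv_le (hNφ j) (hsj j) x fun y hy => hle k j y ?_
    have h1 := le_add_of_lipschitz (helip k) y x
    rw [norm_sub_rev] at h1
    linarith [ht j]
  set Q : Cube n := ⟨0, 6 * R, by positivity⟩ with hQ
  have hQmem : ∀ x, x ∈ Q.set ↔ ‖x‖ ≤ 3 * R := by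
    intro x
    rw [mem_cube_set_iff]
    change ‖x - 0‖ ≤ 6 * R / 2 ↔ _
    rw [sub_zero, show 6 * R / 2 = 3 * R by ring]
  have hQ' : ∀ x ∉ Q.set, 3 * R < ‖x‖ := fun x hx => not_le.1 fun hc => hx ((hQmem x).2 hc)
  have hlev := S.hasDec_levels (N := N) (e := e) (K := K) (Q := Q)
    (B := fun k => (2 + A) * (s₀ * 2 ^ k))
    (fun j => (hc (j + 1)).sub (hc j))
    (fun j => by simpa using (hmφ (j + 1)).sub (hmφ j) (hNφ (j + 1)) (hNφ j))
    (fun j y hy => by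
      have h1 := hhR (j + 1) y hy
      have h2 := hhR j y hy
      simp only [hh] at h1 h2
      rw [h1, h2, add_zero])
    helip (fun k y => Metric.infDist_nonneg)
    (fun k y => Metric.infDist_le_infDist_of_subset (hEmono k) ⟨_, hE0 k⟩)
    (fun y => Metric.infDist_zero_of_mem (by rw [hEK]; trivial))
    (fun k y hy => by
      have : Nonempty (Fin n) := ⟨⟨0, hn⟩⟩
      refine (Metric.infDist_le_dist_of_mem (hE0 k)).trans ?_
      rw [dist_eq_norm]
      refine (norm_sub_le _ _).trans ?_
      rw [pi_norm_const, Real.norm_of_nonneg (by positivity)]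
      linarith)
    (fun k => by positivity)
    (fun k j y hy => by
      have h1 := hle k (j + 1) y (by rw [hhalf]; linarith [ht j])
      have h2 := hle k j y (by linarith [ht j])
      refine (abs_add_le _ _).trans ?_
      have : 0 ≤ A * (s₀ * 2 ^ k) := by positivity
      simp only [hh] at h1 h2
      linarith)
    (fun k j x hx => by
      have h1 := hfsle k j x (by linarith [ht j])
      have h2 := hfsle k (j + 1) x (by rw [hhalf]; linarith [ht j])
      have : 0 ≤ s₀ * 2 ^ k := by positivity
      simp only [hfs, hh] at h1 h2
      exact ⟨by linarith, by linarith⟩)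
    hQ'
  have hfs0 : HasDec N (fs 0) fun x => s₀ * chi Q.set x := by
    refine hasDec_of_nice (hfsN 0) (hfsm 0) Q (fun x hx => hfsR 0 x (hQ' x hx)) fun x => ?_
    by_cases hA0 : A = 0
    · have := abs_conv_le (hNφ 0) (hsj 0) x (g := h 0) (B := (hhN 0).2.1.choose)
        fun y _ => (hhN 0).2.1.choose_spec y
      rw [hAj, hA0, zero_mul] at this
      exact this.trans hs₀.le
    · have hA' : 0 < A := lt_of_le_of_ne hA (Ne.symm hA0)
      have := abs_conv_le (hNφ 0) (hsj 0) x (g := h 0) (B := s₀ / A) fun y _ => by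
        rw [le_div_iff₀ hA', mul_comm]
        simpa [hh] using h0 y
      rwa [hAj, mul_div_cancel₀ _ hA0] at this
  obtain ⟨J, hJ⟩ : ∃ J, ∀ x, |f x - fs J x| ≤ s₀ := by
    have hcs : HasCompactSupport f := HasCompactSupport.intro
      (isCompact_closedBall (0 : Fin n → ℝ) R) fun y hy => hfR y (by simpa using hy)
    have huc := hcs.uniformContinuous_of_continuous hfc
    set ε := s₀ / (A ^ 2 + A + 1) with hε
    obtain ⟨d, hd, hdf⟩ := Metric.uniformContinuous_iff.1 huc ε (by positivity)
    obtain ⟨J, hJ⟩ := pow_unbounded_of_one_lt (R / d) (one_lt_two : (1 : ℝ) < 2)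
    rw [div_lt_iff₀ hd] at hJ
    refine ⟨J, fun x => ?_⟩
    have hone : ∫ z, dil (R / 2 ^ J) φ z = 1 := by
      simpa [mono] using hmφ J 0 (by simp)
    have := abs_conv_conv_sub_le (hNφ J) (hc J) hf hone (hsj J) (ε := ε) (fun x y hxy => by
      have h1 : R / 2 ^ J < d := by
        rw [div_lt_iff₀ (by positivity)]; linarith
      have h2 := hdf (a := y) (b := x) (by rw [dist_comm, dist_eq_norm]; linarith)
      rw [Real.dist_eq] at h2
      exact h2.le) x
    refine this.trans ?_
    rw [hAj, hε, ← mul_div_assoc, div_le_iff₀ (by positivity)]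
    nlinarith
  have hdiff : HasDec N (fun x => f x - fs J x) fun x => s₀ * chi Q.set x := by
    refine hasDec_of_nice (hf.sub (hfsN J)) (by simpa using hfm.sub (hfsm J) hf (hfsN J)) Q
      (fun x hx => ?_) hJ
    have h1 := hQ' x hx
    rw [hfsR J x h1, hfR x (by linarith), sub_zero]
  refine ⟨K, e, Q, fun x hx => (hQmem x).1 hx, fun k x hx => ?_, ?_⟩
  · have hxE : x ∉ E k := fun hmem => hx.ne' (Metric.infDist_zero_of_mem hmem)
    simp only [hE, levelSet, mem_ofPred_eq, not_forall, not_le] at hxE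
    obtain ⟨j, y, h1, h2⟩ := hxE
    exact ⟨j, y, h1, h2.le⟩
  · refine ((hdiff.add hfs0).add (hlev J)).mono (fun x => ?_) fun x => le_of_eq ?_
    · simp only [hfs, hh]
      ring
    · rw [Finset.sum_filter, Finset.mul_sum, ← add_assoc]
      congr 1
      · rw [pow_zero]
        ring
      · refine Finset.sum_congr rfl fun k _ => ?_
        split_ifs
        · rw [pow_succ]
          ring
        · rw [mul_zero]

theorem exists_hasDec_le_grandMax (hn : 1 ≤ n) (N N₀ : ℕ) : ∃ C : ℝ≥0, ∀ f ∈ ON n N,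
    ∃ g, HasDec N f g ∧ ∀ x, ENNReal.ofReal (g x) ≤ C * grandMax n N₀ f x := by
  obtain ⟨φ, hφ, hs, hm⟩ := exists_hasMoments n N
  have hcφ : HasCompactSupport φ := HasCompactSupport.intro
    (isCompact_closedBall (0 : Fin n → ℝ) 1) fun y hy => hs y (by simpa using hy)
  obtain ⟨c, hc, hcM⟩ := conv_le_grandMax n N₀ hφ hcφ (by norm_num : (0 : ℝ) ≤ 40)
  set A := ∫ z, |φ z| with hAdef
  have hA : 0 ≤ A := integral_nonneg fun _ => abs_nonneg _
  set c₁ := 2 + (2 + 4 * A) * (2 + A) with hc₁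
  set c₂ := 5 * 5 ^ n * ((2 + 4 * A + 2 * A * (3 * (3 + 8 * (n : ℝ)))) * (2 + A)) * 2 with hc₂
  have hc₁0 : 0 < c₁ := by positivity
  have hc₂0 : 0 < c₂ := by positivity
  set C := c₁ * (A * c + 1) + c₂ * (2 * c) with hC
  have hC0 : 0 < C := by positivity
  refine ⟨C.toNNReal, fun f ⟨hf, hfc, hfm⟩ => ?_⟩
  by_cases hf0 : ∀ x, f x = 0
  · exact ⟨fun _ => 0, HasDec.zero.mono hf0 fun _ => le_rfl, fun x => by simp⟩
  push Not at hf0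
  obtain ⟨R, hR, hfR⟩ : ∃ R : ℝ, 0 < R ∧ ∀ y, R < ‖y‖ → f y = 0 := by
    obtain ⟨R, hR⟩ := (Metric.isBounded_iff_subset_closedBall 0).1 hfc.isCompact.isBounded
    refine ⟨max R 1, by positivity, fun y hy => ?_⟩
    by_contra hne
    have := hR (subset_tsupport f hne)
    rw [mem_closedBall_zero_iff] at this
    linarith [le_max_left R 1]
  have hfN : Nice f := nice_of_continuous hf.continuous hfR
  have hfm' : HasMoments N 0 f := fun β hβ => by simpa [mono] using hfm β hβ
  obtain ⟨μ, hμ, hμM⟩ := exists_le_grandMax N₀ hf hfc hf0 (by positivity : 0 ≤ 3 * R)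
  have hdc := continuous_dil hφ.continuous R
  have hds := dil_support hR hs
  have hdN : Nice (dil R φ) := nice_of_continuous hdc hds
  obtain ⟨u, hu, humax⟩ := (isCompact_closedBall (0 : Fin n → ℝ) (2 * R)).exists_isMaxOn
    ⟨0, by simp [hR.le]⟩ (continuous_conv hdN hdc hfN).abs.continuousOn
  have hu' : ‖u‖ ≤ 2 * R := by simpa using hu
  set b := |conv (dil R φ) f u| with hb
  have hb0 : 0 ≤ b := abs_nonneg _
  have hble : ∀ y, |conv (dil R φ) f y| ≤ b := by
    intro y
    rcases le_or_gt ‖y‖ (2 * R) with hy | hy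
    · exact humax (by simpa using hy)
    · rw [conv_support hds hfR y (by linarith), abs_zero]
      exact hb0
  set s₀ := A * b + μ with hs₀
  have hs₀0 : 0 < s₀ := by positivity
  obtain ⟨K, e, Q, hQ, he, hdec⟩ := exists_hasDec_levels hn hφ.continuous hs hm hf.continuous
    hfm' hR hfR hs₀0 fun y => by
      have := mul_le_mul_of_nonneg_left (hble y) hA
      linarith
  refine ⟨_, hdec, fun x => ?_⟩
  by_cases hM : grandMax n N₀ f x = ∞
  · rw [hM, ENNReal.mul_top (by simpa using hC0)]
    exact le_top
  obtain ⟨M, hM0, hMx⟩ : ∃ M : ℝ, 0 ≤ M ∧ grandMax n N₀ f x = ENNReal.ofReal M :=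
    ⟨_, ENNReal.toReal_nonneg, (ENNReal.ofReal_toReal hM).symm⟩
  rw [hMx]
  change _ ≤ ENNReal.ofReal C * ENNReal.ofReal M
  rw [← ENNReal.ofReal_mul hC0.le]
  refine ENNReal.ofReal_le_ofReal ?_
  have hcM' : ∀ t y, 0 < t → ‖y - x‖ ≤ 40 * t → |conv (dil t φ) f y| ≤ c * M := by
    intro t y ht hy
    have := hcM f t y x ht hy
    rw [hMx, ← ENNReal.ofReal_mul hc.le] at this
    exact (ENNReal.ofReal_le_ofReal_iff (by positivity)).1 this
  have h1 : s₀ * chi Q.set x ≤ (A * c + 1) * M := by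
    by_cases hx : x ∈ Q.set
    · have hxR := hQ x hx
      have i1 : b ≤ c * M := hcM' R u hR (by linarith [norm_sub_le u x])
      have i2 : μ ≤ M := by
        have := hμM x hxR
        rw [hMx] at this
        exact (ENNReal.ofReal_le_ofReal_iff hM0).1 this
      have i3 := mul_le_mul_of_nonneg_left i1 hA
      simp only [chi, indicator_of_mem hx, mul_one]
      linarith
    · simp only [chi, indicator_of_notMem hx, mul_zero]
      positivity
  have h2 : ∑ k ∈ (Finset.range K).filter (fun k => 0 < e k x), s₀ * 2 ^ k ≤ 2 * (c * M) := by
    refine sum_mul_two_pow_le _ hs₀0.le (by positivity) fun k hk => ?_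
    obtain ⟨j, y, hy, hsy⟩ := he k x (Finset.mem_filter.1 hk).2
    exact hsy.trans (hcM' _ y (by positivity) hy)
  have h3 := mul_le_mul_of_nonneg_left h1 hc₁0.le
  have h4 := mul_le_mul_of_nonneg_left h2 hc₂0.le
  linarith

lemma wLpNormE_le_const_mul {p : ℝ} (hp : 0 < p) (w : (Fin n → ℝ) → ℝ)
    {u v : (Fin n → ℝ) → ℝ≥0∞} (C : ℝ≥0) (h : ∀ x, u x ≤ C * v x) :
    wLpNormE p w u ≤ C * wLpNormE p w v := by
  have h1 : ∫⁻ x, u x ^ p ∂wMeasure w ≤ (C : ℝ≥0∞) ^ p * ∫⁻ x, v x ^ p ∂wMeasure w := by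
    rw [← lintegral_const_mul' _ _ (ENNReal.rpow_ne_top_of_nonneg hp.le ENNReal.coe_ne_top)]
    refine lintegral_mono fun x => ?_
    rw [← ENNReal.mul_rpow_of_nonneg _ _ hp.le]
    exact ENNReal.rpow_le_rpow (h x) hp.le
  refine (ENNReal.rpow_le_rpow h1 (by positivity)).trans (le_of_eq ?_)
  rw [ENNReal.mul_rpow_of_nonneg _ _ (by positivity), ← ENNReal.rpow_mul, mul_one_div_cancel hp.ne',
    ENNReal.rpow_one]
  rfl

end Main

/-- Theorem 2.6: finite atomic decomposition in weighted Hardy spaces. -/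
theorem statement4 (n : ℕ) (hn : 1 ≤ n)
    (w : (Fin n → ℝ) → ℝ) (hw : IsAinf w)
    (p : ℝ) (hp : 0 < p) (N : ℕ) (hN : critIndex w p ≤ (N : ℤ)) :
    ∃ N₀₀ : ℕ, ∀ N₀ : ℕ, N₀₀ ≤ N₀ → ∃ C : ℝ≥0,
      ∀ f ∈ ON n N, HpNorm n N₀ p w f ≠ ∞ →
        ∃ (L : ℕ) (lam : Fin L → ℝ) (a : Fin L → (Fin n → ℝ) → ℝ) (Q : Fin L → Cube n),
          (∀ j, 0 ≤ lam j) ∧ (∀ j, IsAtom N (a j) (Q j)) ∧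
          (∀ x, f x = ∑ j, lam j * a j x) ∧
          wLpNorm p w (fun x => ∑ j, lam j * chi (Q j).set x) ≤
            C * HpNorm n N₀ p w f := by
  refine ⟨0, fun N₀ _ => ?_⟩
  obtain ⟨C, hC⟩ := exists_hasDec_le_grandMax hn N N₀
  refine ⟨C, fun f hf _ => ?_⟩
  obtain ⟨g, ⟨L, lam, a, Q, h1, h2, h3, h4⟩, hg⟩ := hC f hf
  refine ⟨L, lam, a, Q, h1, h2, h3, wLpNormE_le_const_mul hp w C fun x => ?_⟩
  have h5 : 0 ≤ ∑ j, lam j * chi (Q j).set x := Finset.sum_nonneg fun j _ =>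
    mul_nonneg (h1 j) (indicator_nonneg (fun _ _ => zero_le_one) _)
  rw [abs_of_nonneg h5]
  exact (ENNReal.ofReal_le_ofReal (h4 x)).trans (hg x)

end Paper

end
end

section
/- Let μ be a doubling Borel measure on ℝ^n and fix 0<p<1. Then there is a constant C = C(μ,p,n) such that for every finite collection 𝒥 of cubes and every set {f_Q : Q ∈ 𝒥} of nonnegative μ-integrable functions with supp(f_Q) ⊂ Q, one has ‖Σ_{Q∈𝒥} f_Q‖_{L^p(μ)} ≤ C ‖Σ_{Q∈𝒥} a_1^μ(Q) χ_Q‖_{L^p(μ)}, where a_1^μ(Q) = μ(Q)^{−1} ∫_Q f_Q dμ. -/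
open MeasureTheory Set
open scoped ENNReal BigOperators NNReal

noncomputable section

namespace Paper

theorem measurable_sup_indicator {α ι : Type*} [MeasurableSpace α] [Fintype ι] {A : ι → Set α}
    (hA : ∀ i, MeasurableSet (A i)) (c : ι → ℝ≥0) :
    Measurable fun x => Finset.univ.sup fun i => (A i).indicator (fun _ => c i) x := by
  have : (fun x => Finset.univ.sup fun i => (A i).indicator (fun _ => c i) x) =
      Finset.univ.sup fun i => (A i).indicator (fun _ => c i) := by
    ext x; simp [Finset.sup_apply]
  rw [this]
  exact Finset.sup_induction measurable_const (fun _ h₁ _ h₂ => h₁.sup h₂)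
    fun i _ => measurable_const.indicator (hA i)

/-- The maximal function over a finite family of sets with the Vitali covering property is bounded
on `L²`. -/
theorem lintegral_sq_sup_indicator_le {α ι : Type*} [MeasurableSpace α] [Fintype ι]
    {μ : Measure α} {A : ι → Set α} (hA : ∀ i, MeasurableSet (A i)) (hfin : ∀ i, μ (A i) ≠ ∞)
    {K : ℝ≥0}
    (hV : ∀ I : Finset ι, ∃ J ⊆ I, (J : Set ι).PairwiseDisjoint A ∧
      μ (⋃ i ∈ I, A i) ≤ K * ∑ i ∈ J, μ (A i))
    {g : α → ℝ≥0} (hg : Measurable g) {c : ι → ℝ≥0}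
    (hc : ∀ i, c i * μ (A i) ≤ ∫⁻ x in A i, g x ∂μ) :
    ∫⁻ x, ((Finset.univ.sup fun i => (A i).indicator (fun _ => c i) x : ℝ≥0) : ℝ≥0∞) ^ 2 ∂μ ≤
      4 * K ^ 2 * ∫⁻ x, (g x : ℝ≥0∞) ^ 2 ∂μ := by
  classical
  set m : α → ℝ≥0 := fun x => Finset.univ.sup fun i => (A i).indicator (fun _ => c i) x with hm
  have hmm : Measurable m := measurable_sup_indicator hA c
  have hlevel : ∀ t : ℝ≥0, {x | t < m x} = ⋃ i ∈ Finset.univ.filter (fun i => t < c i), A i := by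
    intro t
    ext x
    simp only [mem_ofPred_eq, hm, Finset.lt_sup_iff, Finset.mem_univ, true_and, mem_iUnion,
      Finset.mem_filter, exists_prop]
    refine exists_congr fun i => ?_
    by_cases hx : x ∈ A i <;> simp [hx]
  have hweak : ∀ t : ℝ≥0, μ {x | t < m x} * t ≤
      K * (μ.withDensity fun x => (g x : ℝ≥0∞)) {x | t < m x} := by
    intro t
    obtain ⟨J, hJI, hJd, hJ⟩ := hV (Finset.univ.filter (fun i => t < c i))
    rw [← hlevel] at hJ
    have h1 : (∑ i ∈ J, μ (A i)) * t ≤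
        (μ.withDensity fun x => (g x : ℝ≥0∞)) {x | t < m x} := by
      calc (∑ i ∈ J, μ (A i)) * t = ∑ i ∈ J, μ (A i) * t := Finset.sum_mul _ _ _
        _ ≤ ∑ i ∈ J, (μ.withDensity fun x => (g x : ℝ≥0∞)) (A i) := by
          refine Finset.sum_le_sum fun i hi => ?_
          rw [withDensity_apply _ (hA i)]
          refine le_trans ?_ (hc i)
          rw [mul_comm]
          gcongr
          exact (Finset.mem_filter.1 (hJI hi)).2.le
        _ = (μ.withDensity fun x => (g x : ℝ≥0∞)) (⋃ i ∈ J, A i) :=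
          (measure_biUnion_finset hJd fun i _ => hA i).symm
        _ ≤ _ := by
          rw [hlevel]
          exact measure_mono (biUnion_subset_biUnion_left hJI)
    calc μ {x | t < m x} * t ≤ (K * ∑ i ∈ J, μ (A i)) * t := by gcongr
      _ = K * ((∑ i ∈ J, μ (A i)) * t) := mul_assoc _ _ _
      _ ≤ _ := by gcongr
  have hX : ∫⁻ x, (m x : ℝ≥0∞) ^ 2 ∂μ ≠ ∞ := by
    refine ne_of_lt (lt_of_le_of_lt (lintegral_mono (g := fun x => ∑ i, (A i).indicator
      (fun _ => (c i : ℝ≥0∞) ^ 2) x) fun x => ?_) ?_)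
    · by_cases h0 : m x = 0
      · simp [h0]
      obtain ⟨i, -, hi⟩ := Finset.exists_mem_eq_sup' (s := Finset.univ)
        (Finset.univ_nonempty_iff.2 (by
          by_contra hne
          rw [not_nonempty_iff] at hne
          exact h0 (by simp [hm]))) (fun i => (A i).indicator (fun _ => c i) x)
      rw [Finset.sup'_eq_sup] at hi
      refine le_trans ?_ (Finset.single_le_sum (fun _ _ => zero_le) (Finset.mem_univ i))
      have hi' : m x = (A i).indicator (fun _ => c i) x := hi
      by_cases hx : x ∈ A i <;> simp_all
    · rw [lintegral_finsetSum _ fun i _ => measurable_const.indicator (hA i)]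
      refine ENNReal.sum_lt_top.2 fun i _ => ?_
      rw [lintegral_indicator_const (hA i)]
      exact ENNReal.mul_lt_top (by simp) (hfin i).lt_top
  have hmr : Measurable fun x => (m x : ℝ) := hmm.coe_nnreal_real
  have h2 := lintegral_rpow_eq_lintegral_meas_lt_mul μ (f := fun x => (m x : ℝ))
    (Filter.Eventually.of_forall fun x => NNReal.coe_nonneg _) hmr.aemeasurable
    (p := 2) two_pos
  have h1 := lintegral_eq_lintegral_meas_lt (μ.withDensity fun x => (g x : ℝ≥0∞))
    (f := fun x => (m x : ℝ))
    (Filter.Eventually.of_forall fun x => NNReal.coe_nonneg _) hmr.aemeasurable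
  have hmain : ∫⁻ x, (m x : ℝ≥0∞) ^ 2 ∂μ ≤ 2 * K * ∫⁻ x, g x * (m x : ℝ≥0∞) ∂μ := by
    have e1 : ∫⁻ x, g x * (m x : ℝ≥0∞) ∂μ =
        ∫⁻ x, ENNReal.ofReal (m x : ℝ) ∂(μ.withDensity fun x => (g x : ℝ≥0∞)) := by
      rw [lintegral_withDensity_eq_lintegral_mul _ hg.coe_nnreal_ennreal
        hmr.ennreal_ofReal]
      simp
    have e2 : ∫⁻ x, (m x : ℝ≥0∞) ^ 2 ∂μ = ∫⁻ x, ENNReal.ofReal ((m x : ℝ) ^ (2 : ℝ)) ∂μ := by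
      simp [ENNReal.ofReal_pow]
    rw [e1, e2, h2, h1, mul_assoc, ← lintegral_const_mul' _ _ ENNReal.coe_ne_top]
    simp only [ENNReal.ofReal_ofNat]
    gcongr 2 * ?_
    refine setLIntegral_mono' measurableSet_Ioi fun t ht => ?_
    lift t to ℝ≥0 using (le_of_lt ht)
    have := hweak t
    norm_num
    exact this
  have hyoung : 2 * K * ∫⁻ x, g x * (m x : ℝ≥0∞) ∂μ ≤
      2 * K ^ 2 * ∫⁻ x, (g x : ℝ≥0∞) ^ 2 ∂μ + (∫⁻ x, (m x : ℝ≥0∞) ^ 2 ∂μ) / 2 := by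
    rw [ENNReal.div_eq_inv_mul, ← lintegral_const_mul' _ _ (by finiteness),
      ← lintegral_const_mul' _ _ (by finiteness), ← lintegral_const_mul' _ _ (by simp),
      ← lintegral_add_left (by fun_prop)]
    refine lintegral_mono fun x => ?_
    have : 2 * K * (g x * m x) ≤ 2 * K ^ 2 * g x ^ 2 + (2 : ℝ≥0)⁻¹ * m x ^ 2 := by
      rw [← NNReal.coe_le_coe]
      push_cast
      nlinarith [sq_nonneg (2 * (K : ℝ) * g x - m x)]
    have h2 : (2⁻¹ : ℝ≥0∞) = ((2⁻¹ : ℝ≥0) : ℝ≥0∞) := by simp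
    simp only [h2]
    exact_mod_cast this
  have hfinal := hmain.trans hyoung
  have hhalf := ENNReal.add_halves (∫⁻ x, (m x : ℝ≥0∞) ^ 2 ∂μ)
  have h3 : (∫⁻ x, (m x : ℝ≥0∞) ^ 2 ∂μ) / 2 ≤ 2 * K ^ 2 * ∫⁻ x, (g x : ℝ≥0∞) ^ 2 ∂μ := by
    refine (ENNReal.add_le_add_iff_right (a := (∫⁻ x, (m x : ℝ≥0∞) ^ 2 ∂μ) / 2)
      (by finiteness)).1 ?_
    rwa [hhalf]
  calc ∫⁻ x, (m x : ℝ≥0∞) ^ 2 ∂μ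
      = 2 * ((∫⁻ x, (m x : ℝ≥0∞) ^ 2 ∂μ) / 2) := by
        rw [ENNReal.mul_div_cancel (by simp) (by simp)]
    _ ≤ 2 * (2 * K ^ 2 * ∫⁻ x, (g x : ℝ≥0∞) ^ 2 ∂μ) := by gcongr
    _ = _ := by ring

/-- Jensen's inequality for the convex function `t ↦ t ^ (-r)`. -/
theorem rpow_neg_mul_measure_le {α : Type*} [MeasurableSpace α] {ν : Measure α}
    (hν : ν univ ≠ ∞) {g : α → ℝ≥0} (hg : Measurable g) (hg0 : ∀ᵐ x ∂ν, g x ≠ 0) {c : ℝ≥0}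
    (hc0 : c ≠ 0) (hc : ∫⁻ x, g x ∂ν ≤ c * ν univ) {r : ℝ} (hr : 0 < r) :
    (c : ℝ≥0∞) ^ (-r) * ν univ ≤ ∫⁻ x, (g x : ℝ≥0∞) ^ (-r) ∂ν := by
  rcases eq_or_ne (ν univ) 0 with h0 | h0
  · simp [h0]
  set V := ν univ with hV
  set I := ∫⁻ x, (g x : ℝ≥0∞) ^ (-r) ∂ν with hI
  have hr1 : 0 < 1 + r := by linarith
  have hholder : V ≤ (∫⁻ x, g x ∂ν) ^ (r / (1 + r)) * I ^ (1 / (1 + r)) := by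
    refine le_trans (le_of_eq ?_) (ENNReal.lintegral_mul_norm_pow_le (μ := ν)
      hg.coe_nnreal_ennreal.aemeasurable (hg.coe_nnreal_ennreal.pow_const (-r)).aemeasurable
      (p := r / (1 + r)) (q := 1 / (1 + r)) (by positivity) (by positivity) (by field_simp; ring))
    rw [hV, ← lintegral_one]
    refine lintegral_congr_ae ?_
    filter_upwards [hg0] with x hx
    rw [← ENNReal.rpow_mul, ← ENNReal.rpow_add _ _ (by simpa using hx) (by simp)]
    rw [show r / (1 + r) + -r * (1 / (1 + r)) = 0 by ring, ENNReal.rpow_zero]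
  have hpow : V ^ (1 + r) ≤ (c * V) ^ r * I := by
    calc V ^ (1 + r) ≤ ((c * V) ^ (r / (1 + r)) * I ^ (1 / (1 + r))) ^ (1 + r) := by
          gcongr
          exact hholder.trans (by gcongr)
      _ = _ := by
          rw [ENNReal.mul_rpow_of_nonneg _ _ hr1.le, ← ENNReal.rpow_mul, ← ENNReal.rpow_mul,
            div_mul_cancel₀ _ hr1.ne', div_mul_cancel₀ _ hr1.ne', ENNReal.rpow_one]
  have hcV0 : (c * V) ^ r ≠ 0 := by
    simp [ENNReal.rpow_eq_zero_iff, h0, hc0, hr.not_gt]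
  have hcVt : (c * V) ^ r ≠ ∞ := by
    refine ENNReal.rpow_ne_top_of_nonneg hr.le (by finiteness)
  refine (ENNReal.mul_le_mul_iff_right hcV0 hcVt).1 (le_trans (le_of_eq ?_) hpow)
  rw [ENNReal.mul_rpow_of_nonneg _ _ hr.le, ENNReal.rpow_add _ _ h0 hν, ENNReal.rpow_one,
    ENNReal.rpow_neg]
  calc (c : ℝ≥0∞) ^ r * V ^ r * (((c : ℝ≥0∞) ^ r)⁻¹ * V)
      = ((c : ℝ≥0∞) ^ r * ((c : ℝ≥0∞) ^ r)⁻¹) * (V * V ^ r) := by ring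
    _ = V * V ^ r := by
      rw [ENNReal.mul_inv_cancel (by simp [ENNReal.rpow_eq_zero_iff, hc0, hr.not_gt])
        (ENNReal.rpow_ne_top_of_nonneg hr.le (by simp)), one_mul]

theorem exists_setLIntegral_eq_mul {α : Type*} [MeasurableSpace α] {μ : Measure α} {s : Set α}
    (hs : μ s ≠ ∞) {f : α → ℝ≥0∞} (hf : ∫⁻ x in s, f x ∂μ ≠ ∞) :
    ∃ a : ℝ≥0, (∫⁻ x in s, f x ∂μ) / μ s = a ∧ ∫⁻ x in s, f x ∂μ = a * μ s ∧
      (μ s = 0 → a = 0) := by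
  rcases eq_or_ne (μ s) 0 with h | h
  · exact ⟨0, by simp [Measure.restrict_eq_zero.2 h, h]⟩
  · lift (∫⁻ x in s, f x ∂μ) / μ s to ℝ≥0 using ENNReal.div_ne_top hf h with a ha
    exact ⟨a, rfl, by rw [ha, ENNReal.div_mul_cancel h hs], fun h' => absurd h' h⟩

theorem lintegral_rpow_le_mul_rpow_neg {α : Type*} [MeasurableSpace α] {μ : Measure α}
    {F : α → ℝ≥0∞} (hF : AEMeasurable F μ) {m : α → ℝ≥0} (hm : Measurable m)
    (hFm : ∀ᵐ x ∂μ, m x = 0 → F x = 0) {p : ℝ} (hp0 : 0 < p) (hp1 : p < 1) :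
    ∫⁻ x, F x ^ p ∂μ ≤ (∫⁻ x, F x * (m x : ℝ≥0∞) ^ (-(2 * (1 - p) / p)) ∂μ) ^ p *
      (∫⁻ x, (m x : ℝ≥0∞) ^ 2 ∂μ) ^ (1 - p) := by
  refine le_trans (lintegral_mono_ae ?_) (ENNReal.lintegral_mul_norm_pow_le
    (hF.mul (hm.coe_nnreal_ennreal.pow_const _).aemeasurable)
    (hm.coe_nnreal_ennreal.pow_const 2).aemeasurable hp0.le (by linarith) (by ring))
  filter_upwards [hFm] with x hx
  rcases eq_or_ne (m x) 0 with h | h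
  · simp [hx h, hp0]
  · have h' : (m x : ℝ≥0∞) ≠ 0 := by simpa using h
    have hexp : -(2 * (1 - p) / p) * p + ((2 : ℕ) : ℝ) * (1 - p) = 0 := by
      push_cast
      field_simp
      ring
    rw [Pi.mul_apply, ENNReal.mul_rpow_of_nonneg _ _ hp0.le, mul_assoc, ← ENNReal.rpow_mul,
      ← ENNReal.rpow_natCast, ← ENNReal.rpow_mul, ← ENNReal.rpow_add _ _ h' (by simp), hexp]
    simp

theorem lintegral_sum_rpow_le_of_setLIntegral_eq {α ι : Type*} [MeasurableSpace α] [Fintype ι]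
    {μ : Measure α} {A : ι → Set α} (hA : ∀ i, MeasurableSet (A i)) (hfin : ∀ i, μ (A i) ≠ ∞)
    {K : ℝ≥0}
    (hV : ∀ I : Finset ι, ∃ J ⊆ I, (J : Set ι).PairwiseDisjoint A ∧
      μ (⋃ i ∈ I, A i) ≤ K * ∑ i ∈ J, μ (A i))
    {f : ι → α → ℝ≥0∞} (hf : ∀ i, AEMeasurable (f i) μ) (hfA : ∀ i, ∀ x ∉ A i, f i x = 0)
    {a : ι → ℝ≥0} (haμ : ∀ i, ∫⁻ y in A i, f i y ∂μ = a i * μ (A i))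
    (ha0 : ∀ i, μ (A i) = 0 → a i = 0) {p : ℝ} (hp0 : 0 < p) (hp1 : p < 1) :
    ∫⁻ x, (∑ i, f i x) ^ p ∂μ ≤ (4 * K ^ 2 : ℝ≥0∞) ^ (1 - p) *
      ∫⁻ x, ((∑ i, (A i).indicator (fun _ => a i) x : ℝ≥0) : ℝ≥0∞) ^ p ∂μ := by
  have hq : 0 < 1 - p := by linarith
  set G : α → ℝ≥0 := fun x => ∑ i, (A i).indicator (fun _ => a i) x with hG
  have hGm : Measurable G := Finset.measurable_fun_sum _ fun i _ =>
    measurable_const.indicator (hA i)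
  set g : α → ℝ≥0 := fun x => G x ^ (p / 2) with hg
  have hgm : Measurable g := hGm.pow_const _
  have hGle : ∀ i, ∀ x ∈ A i, a i ≤ G x := fun i x hx => by
    refine le_trans (le_of_eq ?_) (Finset.single_le_sum
      (f := fun i => (A i).indicator (fun _ => a i) x) (fun _ _ => zero_le) (Finset.mem_univ i))
    simp [hx]
  have hgt : ∀ i, ∫⁻ x in A i, g x ∂μ ≠ ∞ := fun i => by
    have hle : ∀ x, g x ≤ (∑ i, a i) ^ (p / 2) := fun x => by
      refine NNReal.rpow_le_rpow (Finset.sum_le_sum fun j _ => ?_) (by positivity)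
      exact Set.indicator_le_self' (fun _ _ => zero_le) x
    refine ne_of_lt (lt_of_le_of_lt (lintegral_mono fun x =>
      ENNReal.coe_le_coe.2 (hle x)) ?_)
    rw [setLIntegral_const]
    exact ENNReal.mul_lt_top ENNReal.coe_lt_top (hfin i).lt_top
  choose c _ hcμ _ using fun i => exists_setLIntegral_eq_mul (hfin i) (hgt i)
  have hc0 : ∀ i, a i ≠ 0 → c i ≠ 0 := fun i hi hci => by
    have hμi : μ (A i) ≠ 0 := fun h => hi (ha0 i h)
    have h1 : ((a i ^ (p / 2) : ℝ≥0) : ℝ≥0∞) * μ (A i) ≤ ∫⁻ y in A i, g y ∂μ := by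
      rw [← setLIntegral_const]
      refine setLIntegral_mono' (hA i) fun x hx => ENNReal.coe_le_coe.2 ?_
      exact NNReal.rpow_le_rpow (hGle i x hx) (by positivity)
    rw [hcμ, hci] at h1
    simp [hμi, hi] at h1
  have hmax := lintegral_sq_sup_indicator_le hA hfin hV hgm (fun i => (hcμ i).ge)
  set m : α → ℝ≥0 := fun x => Finset.univ.sup fun i => (A i).indicator (fun _ => c i) x with hm
  have hmm : Measurable m := measurable_sup_indicator hA c
  have hcm : ∀ i, ∀ x ∈ A i, c i ≤ m x := fun i x hx => by
    refine le_trans (le_of_eq ?_) (Finset.le_sup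
      (f := fun i => (A i).indicator (fun _ => c i) x) (Finset.mem_univ i))
    simp [hx]
  have hg2 : ∫⁻ x, (g x : ℝ≥0∞) ^ 2 ∂μ = ∫⁻ x, (G x : ℝ≥0∞) ^ p ∂μ := by
    refine lintegral_congr fun x => ?_
    rw [hg, ENNReal.coe_rpow_of_nonneg _ (by positivity), ← ENNReal.rpow_natCast,
      ← ENNReal.rpow_mul]
    congr 1
    push_cast
    ring
  rw [hg2] at hmax
  set r : ℝ := 2 * (1 - p) / p with hr
  have hr0 : 0 < r := by positivity
  have hfae : ∀ i, a i = 0 → f i =ᵐ[μ] 0 := fun i hi => by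
    have h0 : ∫⁻ y in A i, f i y ∂μ = 0 := by rw [haμ, hi]; simp
    rw [setLIntegral_eq_of_support_subset] at h0
    · exact (lintegral_eq_zero_iff' (hf i)).1 h0
    · intro x hx
      by_contra hxA
      exact hx (hfA i x hxA)
  have hfint : ∀ i, ∫⁻ x, f i x ∂μ = a i * μ (A i) := fun i => by
    rw [← haμ, setLIntegral_eq_of_support_subset]
    intro x hx
    by_contra hxA
    exact hx (hfA i x hxA)
  have hterm : ∀ i, ∫⁻ x, f i x * (m x : ℝ≥0∞) ^ (-r) ∂μ ≤
      a i * ∫⁻ x in A i, (g x : ℝ≥0∞) ^ (-r) ∂μ := fun i => by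
    rcases eq_or_ne (a i) 0 with hi | hi
    · rw [hi]
      simp only [ENNReal.coe_zero, zero_mul, nonpos_iff_eq_zero]
      rw [← lintegral_zero (μ := μ)]
      refine lintegral_congr_ae ?_
      filter_upwards [hfae i hi] with x hx
      simp [hx]
    · calc ∫⁻ x, f i x * (m x : ℝ≥0∞) ^ (-r) ∂μ
          ≤ ∫⁻ x, f i x * (c i : ℝ≥0∞) ^ (-r) ∂μ := by
            refine lintegral_mono fun x => ?_
            by_cases hx : x ∈ A i
            · dsimp only
              rw [ENNReal.rpow_neg, ENNReal.rpow_neg]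
              gcongr
              exact hcm i x hx
            · simp [hfA i x hx]
        _ = a i * ((c i : ℝ≥0∞) ^ (-r) * μ (A i)) := by
            rw [lintegral_mul_const'' _ (hf i), hfint]
            ring
        _ ≤ _ := by
            gcongr
            rw [← Measure.restrict_apply_univ (μ := μ)]
            refine rpow_neg_mul_measure_le (by simpa using hfin i) hgm ?_ (hc0 i hi) ?_ hr0
            · refine (ae_restrict_iff' (hA i)).2 (Filter.Eventually.of_forall fun x hx => ?_)
              exact (NNReal.rpow_pos ((pos_iff_ne_zero.2 hi).trans_le (hGle i x hx))).ne'
            · rw [hcμ, Measure.restrict_apply_univ]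
  have hFw : ∫⁻ x, (∑ i, f i x) * (m x : ℝ≥0∞) ^ (-r) ∂μ ≤ ∫⁻ x, (G x : ℝ≥0∞) ^ p ∂μ := by
    have hgr : ∀ x, (g x : ℝ≥0∞) ^ (-r) = (G x : ℝ≥0∞) ^ (p - 1) := fun x => by
      rw [hg, ENNReal.coe_rpow_of_nonneg _ (by positivity), ← ENNReal.rpow_mul]
      congr 1
      rw [hr]
      field_simp
      ring
    simp only [Finset.sum_mul]
    rw [lintegral_finsetSum' _ fun i _ => by
      exact (hf i).mul (hmm.coe_nnreal_ennreal.pow_const (-r)).aemeasurable]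
    calc ∑ i, ∫⁻ x, f i x * (m x : ℝ≥0∞) ^ (-r) ∂μ
        ≤ ∑ i, a i * ∫⁻ x in A i, (g x : ℝ≥0∞) ^ (-r) ∂μ :=
          Finset.sum_le_sum fun i _ => hterm i
      _ = ∑ i, ∫⁻ x, ((A i).indicator (fun _ => a i) x : ℝ≥0) * (G x : ℝ≥0∞) ^ (p - 1) ∂μ := by
          refine Finset.sum_congr rfl fun i _ => ?_
          rw [← lintegral_const_mul' _ _ ENNReal.coe_ne_top, ← lintegral_indicator (hA i)]
          refine lintegral_congr fun x => ?_
          by_cases hx : x ∈ A i <;> simp [hx, hgr]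
      _ = ∫⁻ x, (G x : ℝ≥0∞) * (G x : ℝ≥0∞) ^ (p - 1) ∂μ := by
          rw [← lintegral_finsetSum _ fun i _ => by
            exact (measurable_const.indicator (hA i)).coe_nnreal_ennreal.mul
              (hGm.coe_nnreal_ennreal.pow_const (p - 1))]
          refine lintegral_congr fun x => ?_
          rw [← Finset.sum_mul]
          simp only [hG]
          push_cast
          rfl
      _ ≤ _ := by
          refine lintegral_mono fun x => ?_
          dsimp only
          rcases eq_or_ne (G x) 0 with h | h
          · simp [h]
          · have h' : (G x : ℝ≥0∞) ≠ 0 := by simpa using h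
            nth_rewrite 1 [← ENNReal.rpow_one (G x : ℝ≥0∞)]
            rw [← ENNReal.rpow_add _ _ h' ENNReal.coe_ne_top, add_sub_cancel]
  calc ∫⁻ x, (∑ i, f i x) ^ p ∂μ
      ≤ (∫⁻ x, (∑ i, f i x) * (m x : ℝ≥0∞) ^ (-r) ∂μ) ^ p *
          (∫⁻ x, (m x : ℝ≥0∞) ^ 2 ∂μ) ^ (1 - p) := by
        refine lintegral_rpow_le_mul_rpow_neg (Finset.aemeasurable_fun_sum _ fun i _ => hf i) hmm
          ?_ hp0 hp1
        have hz : ∀ᵐ x ∂μ, ∀ i, a i = 0 → f i x = 0 := by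
          rw [ae_all_iff]
          intro i
          by_cases hi : a i = 0
          · filter_upwards [hfae i hi] with x hx _ using hx
          · exact Filter.Eventually.of_forall fun x h => absurd h hi
        filter_upwards [hz] with x hx h
        exact Finset.sum_eq_zero fun i _ => by
          by_cases hxA : x ∈ A i
          · refine hx i (not_not.1 fun hi => hc0 i hi ?_)
            exact le_antisymm (h ▸ hcm i x hxA) zero_le
          · exact hfA i x hxA
    _ ≤ (∫⁻ x, (G x : ℝ≥0∞) ^ p ∂μ) ^ p *
          (4 * K ^ 2 * ∫⁻ x, (G x : ℝ≥0∞) ^ p ∂μ) ^ (1 - p) := by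
        gcongr
    _ = _ := by
        rw [ENNReal.mul_rpow_of_nonneg _ _ hq.le, mul_left_comm,
          ← ENNReal.rpow_add_of_nonneg _ _ hp0.le hq.le,
          add_sub_cancel, ENNReal.rpow_one]

/-- The averaging inequality for a finite family of sets with the Vitali covering property. -/
theorem lintegral_sum_rpow_le_sum_average {α ι : Type*} [MeasurableSpace α] [Fintype ι]
    {μ : Measure α} {A : ι → Set α} (hA : ∀ i, MeasurableSet (A i)) (hfin : ∀ i, μ (A i) ≠ ∞)
    {K : ℝ≥0}
    (hV : ∀ I : Finset ι, ∃ J ⊆ I, (J : Set ι).PairwiseDisjoint A ∧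
      μ (⋃ i ∈ I, A i) ≤ K * ∑ i ∈ J, μ (A i))
    {f : ι → α → ℝ≥0∞} (hf : ∀ i, AEMeasurable (f i) μ) (hf' : ∀ i, ∫⁻ x in A i, f i x ∂μ ≠ ∞)
    (hfA : ∀ i, ∀ x ∉ A i, f i x = 0) {p : ℝ} (hp0 : 0 < p) (hp1 : p < 1) :
    ∫⁻ x, (∑ i, f i x) ^ p ∂μ ≤ (4 * K ^ 2 : ℝ≥0∞) ^ (1 - p) *
      ∫⁻ x, (∑ i, ((∫⁻ y in A i, f i y ∂μ) / μ (A i)) *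
        (A i).indicator (fun _ => (1 : ℝ≥0∞)) x) ^ p ∂μ := by
  choose a haE haμ ha0 using fun i => exists_setLIntegral_eq_mul (hfin i) (hf' i)
  have hG : ∀ x, ∑ i, ((∫⁻ y in A i, f i y ∂μ) / μ (A i)) *
      (A i).indicator (fun _ => (1 : ℝ≥0∞)) x =
        ((∑ i, (A i).indicator (fun _ => a i) x : ℝ≥0) : ℝ≥0∞) := fun x => by
    push_cast
    refine Finset.sum_congr rfl fun i _ => ?_
    rw [haE]
    by_cases hx : x ∈ A i <;> simp [hx]
  simp only [hG]
  exact lintegral_sum_rpow_le_of_setLIntegral_eq hA hfin hV hf hfA haμ ha0 hp0 hp1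

theorem Cube.scaleSet_eq_closedBall {n : ℕ} (Q : Cube n) {τ : ℝ} (hτ : 0 ≤ τ) :
    Q.scaleSet τ = Metric.closedBall Q.c (τ * (Q.h / 2)) := by
  have := Q.h_pos
  ext x
  rw [Metric.mem_closedBall, dist_pi_le_iff (by positivity)]
  simp only [Cube.scaleSet, mem_ofPred_eq, Real.dist_eq, mul_div_assoc]

theorem Cube.set_eq_closedBall {n : ℕ} (Q : Cube n) :
    Q.set = Metric.closedBall Q.c (Q.h / 2) := by
  simpa [Cube.scaleSet, Cube.set] using Q.scaleSet_eq_closedBall zero_le_one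

theorem Cube.measure_closedBall_eight_mul_le {n : ℕ} {μ : Measure (Fin n → ℝ)} {D : ℝ≥0}
    (hμ : ∀ Q : Cube n, μ (Cube.scaleSet 2 Q) ≤ D * μ Q.set) (Q : Cube n) :
    μ (Metric.closedBall Q.c (8 * (Q.h / 2))) ≤ D ^ 3 * μ Q.set := by
  have hball : ∀ ρ : ℝ, 0 < ρ → μ (Metric.closedBall Q.c (2 * ρ)) ≤
      D * μ (Metric.closedBall Q.c ρ) := fun ρ hρ => by
    have h := hμ ⟨Q.c, 2 * ρ, by positivity⟩
    rw [Cube.scaleSet_eq_closedBall _ zero_le_two, Cube.set_eq_closedBall] at h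
    simpa using h
  have hQ := Q.h_pos
  rw [Q.set_eq_closedBall]
  calc μ (Metric.closedBall Q.c (8 * (Q.h / 2)))
      = μ (Metric.closedBall Q.c (2 * (2 * (2 * (Q.h / 2))))) := by ring_nf
    _ ≤ D * (D * (D * μ (Metric.closedBall Q.c (Q.h / 2)))) := by
        refine (hball _ (by positivity)).trans ?_
        gcongr
        refine (hball _ (by positivity)).trans ?_
        gcongr
        exact hball _ (by positivity)
    _ = _ := by ring

theorem Cube.exists_disjoint_subfamily {n : ℕ} {μ : Measure (Fin n → ℝ)} {D : ℝ≥0}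
    (hμ : ∀ Q : Cube n, μ (Cube.scaleSet 2 Q) ≤ D * μ Q.set) {ι : Type*} (Q : ι → Cube n)
    (I : Finset ι) :
    ∃ J ⊆ I, (J : Set ι).PairwiseDisjoint (fun i => (Q i).set) ∧
      μ (⋃ i ∈ I, (Q i).set) ≤ (D ^ 3 : ℝ≥0) * ∑ i ∈ J, μ (Q i).set := by
  classical
  obtain ⟨R, hR⟩ := (I.image fun i => (Q i).h / 2).exists_le
  obtain ⟨u, huI, hud, hu⟩ := Vitali.exists_disjoint_subfamily_covering_enlargement_closedBall
    (I : Set ι) (fun i => (Q i).c) (fun i => (Q i).h / 2) R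
    (fun i hi => hR _ (Finset.mem_image_of_mem _ hi)) 8 (by norm_num)
  lift u to Finset ι using I.finite_toSet.subset huI
  refine ⟨u, Finset.coe_subset.1 huI, ?_, ?_⟩
  · simpa only [Cube.set_eq_closedBall] using hud
  · have hsub : (⋃ i ∈ I, (Q i).set) ⊆
        ⋃ i ∈ u, Metric.closedBall (Q i).c (8 * ((Q i).h / 2)) := iUnion₂_subset fun i hi => by
      obtain ⟨j, hj, hij⟩ := hu i hi
      rw [Cube.set_eq_closedBall]
      exact hij.trans (subset_biUnion_of_mem (u := fun j =>
        Metric.closedBall (Q j).c (8 * ((Q j).h / 2))) (Finset.mem_coe.1 hj))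
    refine (measure_mono hsub).trans ((measure_biUnion_finset_le _ _).trans ?_)
    rw [Finset.mul_sum]
    push_cast
    exact Finset.sum_le_sum fun i _ => Cube.measure_closedBall_eight_mul_le hμ (Q i)

/-- Lemma 3.2: averaging lemma for doubling measures, `0 < p < 1`. -/
theorem statement7 (n : ℕ) (hn : 1 ≤ n) (μ : Measure (Fin n → ℝ))
    [IsLocallyFiniteMeasure μ]
    (hμ : ∃ C : ℝ≥0, ∀ Q : Cube n, μ (Cube.scaleSet 2 Q) ≤ C * μ Q.set)
    (p : ℝ) (hp0 : 0 < p) (hp1 : p < 1) :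
    ∃ C : ℝ≥0, ∀ (L : ℕ) (Q : Fin L → Cube n) (f : Fin L → (Fin n → ℝ) → ℝ),
      (∀ j, Integrable (f j) μ ∧ (∀ x, 0 ≤ f j x) ∧ ∀ x ∉ (Q j).set, f j x = 0) →
      eLpNormE p μ (fun x => ∑ j, ENNReal.ofReal (f j x)) ≤
        C * eLpNormE p μ (fun x => ∑ j,
          ((∫⁻ y in (Q j).set, ENNReal.ofReal (f j y) ∂μ) / μ (Q j).set) *
            (Q j).set.indicator (fun _ => (1 : ℝ≥0∞)) x) := by
  obtain ⟨D, hD⟩ := hμ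
  refine ⟨((4 * (D ^ 3) ^ 2) ^ (1 - p)) ^ (1 / p), fun L Q f hf => ?_⟩
  have hset : ∀ j, (Q j).set = Metric.closedBall (Q j).c ((Q j).h / 2) := fun j =>
    (Q j).set_eq_closedBall
  have hmain := lintegral_sum_rpow_le_sum_average (μ := μ) (A := fun j => (Q j).set)
    (f := fun j x => ENNReal.ofReal (f j x))
    (fun j => by rw [hset]; exact Metric.isClosed_closedBall.measurableSet)
    (fun j => by rw [hset]; exact measure_closedBall_lt_top.ne)
    (Cube.exists_disjoint_subfamily hD Q)
    (fun j => (hf j).1.aemeasurable.ennreal_ofReal)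
    (fun j => ((setLIntegral_le_lintegral _ _).trans_lt (hf j).1.lintegral_lt_top).ne)
    (fun j x hx => by simp [(hf j).2.2 x hx]) hp0 hp1
  have hp' : 0 ≤ 1 / p := by positivity
  refine (ENNReal.rpow_le_rpow hmain hp').trans (le_of_eq ?_)
  rw [ENNReal.mul_rpow_of_nonneg _ _ hp', ENNReal.coe_rpow_of_nonneg _ hp',
    ENNReal.coe_rpow_of_nonneg _ (by linarith)]
  push_cast
  rfl

end Paper

end
end
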